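/- Let n ≥ 2, 0 < λ ≤ Λ, q ∈ [0,n), and let v be a generalized solution of λ v^q χ_{{v>0}} ≤ det D²v ≤ Λ v^q χ_{{v>0}} in an open convex set Ω ⊆ ℝⁿ, with coincidence set K := {x ∈ Ω : v(x)=0}. Suppose there exists δ > 0 such that K ⊆ {x : x_n ≥ 0} and K ∩ {x : x_n ≤ δ} is a nonempty compact subset of Ω. Then every point of ∂K ∩ {x : x_n ≤ δ} is an exposed point of K. Consequently (for any such generalized solution v), the set Γ_sc := {x ∈ Ω : x is an exposed point of K} is a relatively open subset of ∂K. -/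

import Mathlib

open MeasureTheory Set Metric
open scoped RealInnerProductSpace

noncomputable section

/-- The subdifferential of a convex function `v` at `x`, relative to the domain `Ω`. -/
def subgrad {n : ℕ} (Ω : Set (EuclideanSpace ℝ (Fin n))) (v : EuclideanSpace ℝ (Fin n) → ℝ)
    (x : EuclideanSpace ℝ (Fin n)) : Set (EuclideanSpace ℝ (Fin n)) :=
  {p | ∀ y ∈ Ω, v x + ⟪p, y - x⟫ ≤ v y}

/-- The image `∂v(E) = ⋃_{x ∈ E} ∂v(x)` of a set under the subdifferential. -/
def subgradImg {n : ℕ} (Ω : Set (EuclideanSpace ℝ (Fin n))) (v : EuclideanSpace ℝ (Fin n) → ℝ)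
    (E : Set (EuclideanSpace ℝ (Fin n))) : Set (EuclideanSpace ℝ (Fin n)) :=
  ⋃ x ∈ E, subgrad Ω v x

/-- The last coordinate `x_n` of a point of `ℝⁿ`. -/
def lastCoord {n : ℕ} (x : EuclideanSpace ℝ (Fin n)) : ℝ :=
  if h : 0 < n then x ⟨n - 1, by omega⟩ else 0

/-- The first `n-1` coordinates `x'` of a point of `ℝⁿ`. -/
def fstCoords {n : ℕ} (x : EuclideanSpace ℝ (Fin n)) : EuclideanSpace ℝ (Fin (n - 1)) :=
  (EuclideanSpace.equiv (Fin (n - 1)) ℝ).symm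
    (fun i => x ⟨i, lt_of_lt_of_le i.isLt (Nat.sub_le n 1)⟩)

/-- The point `(x', t) ∈ ℝⁿ = ℝ^{n-1} × ℝ`. -/
def app (n : ℕ) (x' : EuclideanSpace ℝ (Fin (n - 1))) (t : ℝ) : EuclideanSpace ℝ (Fin n) :=
  (EuclideanSpace.equiv (Fin n) ℝ).symm
    (fun i => if h : (i : ℕ) < n - 1 then x' ⟨i, h⟩ else t)

/-- `v` is a generalized (Aleksandrov) solution of
`λ v^q χ_{v>0} ≤ det D²v ≤ Λ v^q χ_{v>0}` on the open convex set `Ω`: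
`v` is continuous, convex and nonnegative on `Ω`, and for every Borel `E ⊆ Ω` one has
`|∂v(E)| ≤ Λ ∫_{E ∩ {v>0}} v^q` and `|∂v(E ∩ {v>0})| ≥ λ ∫_{E ∩ {v>0}} v^q`. -/
def GenSol (n : ℕ) (q lam Lam : ℝ) (Ω : Set (EuclideanSpace ℝ (Fin n)))
    (v : EuclideanSpace ℝ (Fin n) → ℝ) : Prop :=
  ContinuousOn v Ω ∧ ConvexOn ℝ Ω v ∧ (∀ x ∈ Ω, 0 ≤ v x) ∧
  (∀ E : Set (EuclideanSpace ℝ (Fin n)), MeasurableSet E → E ⊆ Ω →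
    volume (subgradImg Ω v E) ≤
      ENNReal.ofReal Lam * ∫⁻ x in E ∩ {x | 0 < v x}, ENNReal.ofReal (v x ^ q)) ∧
  (∀ E : Set (EuclideanSpace ℝ (Fin n)), MeasurableSet E → E ⊆ Ω →
    ENNReal.ofReal lam * ∫⁻ x in E ∩ {x | 0 < v x}, ENNReal.ofReal (v x ^ q) ≤
      volume (subgradImg Ω v (E ∩ {x | 0 < v x})))

/-- The coincidence set `K = {x ∈ Ω : v x = 0}`. -/
def coin {n : ℕ} (Ω : Set (EuclideanSpace ℝ (Fin n))) (v : EuclideanSpace ℝ (Fin n) → ℝ) :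
    Set (EuclideanSpace ℝ (Fin n)) :=
  {x ∈ Ω | v x = 0}


section LinearAlgebraAux

variable {n : ℕ}

theorem det_adjoint_eq (M : EuclideanSpace ℝ (Fin n) →ₗ[ℝ] EuclideanSpace ℝ (Fin n)) :
    LinearMap.det (LinearMap.adjoint M) = LinearMap.det M := by
  have h := LinearMap.toMatrix_adjoint (EuclideanSpace.basisFun (Fin n) ℝ)
    (EuclideanSpace.basisFun (Fin n) ℝ) M
  rw [← LinearMap.det_toMatrix (EuclideanSpace.basisFun (Fin n) ℝ).toBasis, h,
    Matrix.det_conjTranspose, LinearMap.det_toMatrix]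
  simp

theorem sum_smul_single (t : EuclideanSpace ℝ (Fin n)) :
    ∑ i, t i • EuclideanSpace.single i (1 : ℝ) = t := by
  ext j
  simp [Finset.sum_apply, Pi.single_apply]

/-- The linear map replacing the `i`-th standard basis vector by `z`. -/
def replaceBasisVec (i : Fin n) (z : EuclideanSpace ℝ (Fin n)) :
    EuclideanSpace ℝ (Fin n) →ₗ[ℝ] EuclideanSpace ℝ (Fin n) :=
  LinearMap.transvection (EuclideanSpace.proj i : EuclideanSpace ℝ (Fin n) →L[ℝ] ℝ).toLinearMap
    (z - EuclideanSpace.single i 1)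

theorem replaceBasisVec_apply (i : Fin n) (z x : EuclideanSpace ℝ (Fin n)) :
    replaceBasisVec i z x = x + x i • (z - EuclideanSpace.single i 1) := rfl

theorem det_replaceBasisVec (i : Fin n) (z : EuclideanSpace ℝ (Fin n)) :
    LinearMap.det (replaceBasisVec i z) = z i := by
  simp [replaceBasisVec, LinearMap.transvection.det]

/-- A compact neighbourhood of the origin is comparable to a parallelepiped spanned by
points of that set. -/
theorem exists_inscribed_linearEquiv {S : Set (EuclideanSpace ℝ (Fin n))} (hS : IsCompact S)
    {r : ℝ} (hr : 0 < r) (hball : closedBall 0 r ⊆ S) :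
    ∃ M : EuclideanSpace ℝ (Fin n) ≃ₗ[ℝ] EuclideanSpace ℝ (Fin n),
      (∀ i, M (EuclideanSpace.single i 1) ∈ S) ∧ ∀ s ∈ S, ∀ i, |M.symm s i| ≤ 1 := by
  set b := (EuclideanSpace.basisFun (Fin n) ℝ).toBasis with hb
  have hbi : ∀ i, b i = EuclideanSpace.single i 1 := fun i => by simp [hb]
  have hcpt : IsCompact (Set.univ.pi fun _ : Fin n => S) := isCompact_univ_pi fun _ => hS
  have hne : (Set.univ.pi fun _ : Fin n => S).Nonempty :=
    ⟨fun _ => 0, fun _ _ => hball (mem_closedBall_self hr.le)⟩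
  have hcont : Continuous fun w : Fin n → EuclideanSpace ℝ (Fin n) => |b.det w| := by
    have : ∀ w, b.det w = Matrix.det (b.toMatrix w) := fun w => b.det_apply w
    simp only [this]
    refine (Continuous.matrix_det ?_).abs
    refine continuous_matrix fun i j => ?_
    simp only [Module.Basis.toMatrix_apply, hb]
    simp only [OrthonormalBasis.coe_toBasis_repr_apply, EuclideanSpace.basisFun_repr]
    fun_prop
  obtain ⟨w, hwS, hwmax⟩ := hcpt.exists_isMaxOn hne hcont.continuousOn
  have hdetM : ∀ M : EuclideanSpace ℝ (Fin n) →ₗ[ℝ] EuclideanSpace ℝ (Fin n),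
      b.det (fun i => M (EuclideanSpace.single i 1)) = LinearMap.det M := by
    intro M
    have := b.det_comp M b
    simp only [b.det_self, mul_one] at this
    rw [← this]
    congr 1
    ext1 i
    simp [hbi]
  set M₀ := b.constr ℝ w with hM₀
  have hM₀w : ∀ i, M₀ (EuclideanSpace.single i 1) = w i := fun i => by
    rw [← hbi, hM₀, Module.Basis.constr_basis]
  have hle : ∀ M : EuclideanSpace ℝ (Fin n) →ₗ[ℝ] EuclideanSpace ℝ (Fin n),
      (∀ i, M (EuclideanSpace.single i 1) ∈ S) → |LinearMap.det M| ≤ |LinearMap.det M₀| := by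
    intro M hM
    have h1 := hwmax (show (fun i => M (EuclideanSpace.single i 1)) ∈
      (Set.univ.pi fun _ : Fin n => S) from fun i _ => hM i)
    have h2 : b.det w = LinearMap.det M₀ := by
      rw [← hdetM]; congr 1; ext1 i; rw [hM₀w]
    simpa only [mem_ofPred_eq, hdetM, h2] using h1
  have hdet : LinearMap.det M₀ ≠ 0 := by
    have h1 := hle (r • LinearMap.id) fun i => hball (by
      rw [mem_closedBall_zero_iff, LinearMap.smul_apply, norm_smul]; simp [abs_of_pos hr])
    rw [LinearMap.det_smul, LinearMap.det_id, mul_one] at h1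
    intro h0
    rw [h0, abs_zero] at h1
    exact absurd h1 (not_le.2 (abs_pos.2 (pow_ne_zero _ hr.ne')))
  set M := LinearEquiv.ofIsUnitDet (f := M₀) (v := b) (v' := b)
    (by rw [LinearMap.det_toMatrix]; exact isUnit_iff_ne_zero.2 hdet) with hM
  have hMM : ∀ x, M x = M₀ x := fun x => rfl
  refine ⟨M, fun i => ?_, fun s hs i => ?_⟩
  · rw [hMM, hM₀w]; exact hwS i trivial
  · have h1 := hle (M₀ ∘ₗ replaceBasisVec i (M.symm s)) fun j => by
      rw [LinearMap.comp_apply, replaceBasisVec_apply]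
      by_cases hij : i = j
      · subst hij
        simpa [← hMM] using hs
      · have : (EuclideanSpace.single j (1 : ℝ)) i = 0 := by simp [hij]
        rw [this, zero_smul, add_zero, hM₀w]; exact hwS j trivial
    rw [LinearMap.det_comp, det_replaceBasisVec, abs_mul] at h1
    exact le_of_mul_le_mul_left (by simpa using h1) (abs_pos.2 hdet)

end LinearAlgebraAux

section PolarVolume

variable {n : ℕ}

/-- The open unit cube. -/
def unitCube (n : ℕ) : Set (EuclideanSpace ℝ (Fin n)) := {b | ∀ i, b i ∈ Ioo (0 : ℝ) 1}

theorem volume_unitCube_pos : 0 < volume (unitCube n) := by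
  have hopen : IsOpen (unitCube n) := by
    have : unitCube n = ⋂ i, {b : EuclideanSpace ℝ (Fin n) | b i ∈ Ioo (0 : ℝ) 1} := by
      ext; simp [unitCube]
    rw [this]
    exact isOpen_iInter_of_finite fun i => isOpen_Ioo.preimage (by fun_prop)
  refine hopen.measure_pos volume ⟨WithLp.toLp 2 fun _ => 1 / 2, fun i => ?_⟩
  constructor <;> norm_num

theorem inner_eq_sum (x y : EuclideanSpace ℝ (Fin n)) : ⟪x, y⟫ = ∑ i, x i * y i := by
  simp [PiLp.inner_apply, mul_comm]

theorem adjoint_symm_apply (M : EuclideanSpace ℝ (Fin n) ≃ₗ[ℝ] EuclideanSpace ℝ (Fin n))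
    (b : EuclideanSpace ℝ (Fin n)) :
    LinearMap.adjoint M.toLinearMap (LinearMap.adjoint M.symm.toLinearMap b) = b := by
  rw [← LinearMap.comp_apply, ← LinearMap.adjoint_comp]
  refine ext_inner_right ℝ fun y => ?_
  rw [LinearMap.adjoint_inner_left]
  simp

/-- Lower bound for the volume of the slopes of affine functions staying below `ε` on a set
which is thin in the direction `ξ` on one side of `p`. -/
theorem volume_slopes_ge (hn : 0 < n) {S : Set (EuclideanSpace ℝ (Fin n))}
    {p p₂ ξ : EuclideanSpace ℝ (Fin n)} {ε η d : ℝ}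
    (M : EuclideanSpace ℝ (Fin n) ≃ₗ[ℝ] EuclideanSpace ℝ (Fin n))
    (hε : 0 < ε) (hη : 0 < η) (hd : 0 < d)
    (hM : ∀ x ∈ S, ∀ i, |M.symm (x - p) i| ≤ 1)
    (hξ : ∀ x ∈ S, ⟪ξ, x - p⟫ ≤ η) (hp₂ : p₂ ∈ S) (hξp₂ : ⟪ξ, p₂ - p⟫ ≤ -d) :
    ENNReal.ofReal ((ε / (4 * n)) ^ n * (2 * d / η)) * volume (unitCube n) ≤
      ENNReal.ofReal |LinearMap.det M.toLinearMap| *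
        volume {a : EuclideanSpace ℝ (Fin n) | ∀ x ∈ S, ⟪a, x - p⟫ < ε} := by
  set ζ := LinearMap.adjoint M.toLinearMap ξ with hζ
  have hn' : (0 : ℝ) < n := Nat.cast_pos.2 hn
  have hinner : ∀ a x, ⟪LinearMap.adjoint M.toLinearMap a, M.symm x⟫ = ⟪a, x⟫ := fun a x => by
    rw [LinearMap.adjoint_inner_left]; simp
  obtain ⟨i₀, hi₀⟩ : ∃ i, d / n ≤ |ζ i| := by
    by_contra! hcon
    have h1 : -d ≥ ∑ i, ζ i * M.symm (p₂ - p) i := by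
      rw [← inner_eq_sum, hζ, hinner]; exact hξp₂
    have h2 : ∀ i, -|ζ i| ≤ ζ i * M.symm (p₂ - p) i := fun i => by
      have := abs_mul (ζ i) (M.symm (p₂ - p) i)
      have h3 := mul_le_mul_of_nonneg_left (hM p₂ hp₂ i) (abs_nonneg (ζ i))
      have h4 := neg_abs_le (ζ i * M.symm (p₂ - p) i)
      linarith
    have : Nonempty (Fin n) := ⟨⟨0, hn⟩⟩
    have h5 : ∑ i : Fin n, |ζ i| < ∑ _i : Fin n, d / n :=
      Finset.sum_lt_sum_of_nonempty Finset.univ_nonempty fun i _ => hcon i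
    have h6 : ∑ i, -|ζ i| ≤ ∑ i, ζ i * M.symm (p₂ - p) i := Finset.sum_le_sum fun i _ => h2 i
    rw [Finset.sum_neg_distrib] at h6
    rw [Finset.sum_const, Finset.card_univ, Fintype.card_fin, nsmul_eq_mul,
      mul_div_cancel₀ _ hn'.ne'] at h5
    linarith
  set s := ε / (4 * n) with hs
  have hs0 : 0 < s := by positivity
  set W := s • replaceBasisVec i₀ ((2 * n / η) • ζ) with hW
  have hsub : W '' unitCube n ⊆ LinearMap.adjoint M.toLinearMap ''
      {a : EuclideanSpace ℝ (Fin n) | ∀ x ∈ S, ⟪a, x - p⟫ < ε} := by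
    rintro _ ⟨b, hb, rfl⟩
    refine ⟨LinearMap.adjoint M.symm.toLinearMap (W b), fun x hx => ?_, adjoint_symm_apply M _⟩
    rw [← hinner, adjoint_symm_apply, hW, LinearMap.smul_apply, replaceBasisVec_apply,
      inner_smul_left, inner_add_left, inner_smul_left, inner_sub_left, inner_smul_left, hζ, hinner]
    set t := M.symm (x - p) with ht
    have h1 : ⟪b, t⟫ - b i₀ * t i₀ ≤ n := by
      rw [inner_eq_sum, ← Finset.add_sum_erase _ _ (Finset.mem_univ i₀), add_sub_cancel_left]
      have h2 : ∑ i ∈ Finset.univ.erase i₀, b i * t i ≤ ∑ i ∈ Finset.univ.erase i₀, (1 : ℝ) := by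
        refine Finset.sum_le_sum fun i _ => ?_
        have h3 := hM x hx i
        have h4 := hb i
        calc b i * t i ≤ b i * 1 := mul_le_mul_of_nonneg_left (le_of_abs_le h3) h4.1.le
          _ ≤ 1 := by linarith [h4.2]
      refine h2.trans ?_
      rw [Finset.sum_const, nsmul_eq_mul, mul_one]
      exact_mod_cast (Finset.card_le_univ _).trans (by simp)
    have h5 : b i₀ * (2 * n / η * ⟪ξ, x - p⟫) ≤ 2 * n := by
      have h6 := hξ x hx
      have h7 := hb i₀
      have h8 : 2 * n / η * ⟪ξ, x - p⟫ ≤ 2 * n := by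
        calc 2 * n / η * ⟪ξ, x - p⟫ ≤ 2 * n / η * η :=
              mul_le_mul_of_nonneg_left h6 (by positivity)
          _ = 2 * n := by field_simp
      calc b i₀ * (2 * n / η * ⟪ξ, x - p⟫) ≤ b i₀ * (2 * n) :=
            mul_le_mul_of_nonneg_left h8 h7.1.le
        _ ≤ 1 * (2 * n) := mul_le_mul_of_nonneg_right h7.2.le (by positivity)
        _ = 2 * n := one_mul _
    have h9 : ⟪EuclideanSpace.single i₀ (1 : ℝ), t⟫ = t i₀ := by
      simp [EuclideanSpace.inner_single_left]
    rw [h9]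
    simp only [conj_trivial]
    calc s * (⟪b, t⟫ + b i₀ * (2 * n / η * ⟪ξ, x - p⟫ - t i₀)) ≤ s * (3 * n) := by
          refine mul_le_mul_of_nonneg_left ?_ hs0.le
          linarith
      _ = 3 / 4 * ε := by rw [hs]; field_simp
      _ < ε := by linarith
  have hvol := measure_mono (μ := volume) hsub
  rw [Measure.addHaar_image_linearMap, Measure.addHaar_image_linearMap, det_adjoint_eq, hW,
    LinearMap.det_smul, det_replaceBasisVec] at hvol
  refine le_trans (mul_le_mul_left (ENNReal.ofReal_le_ofReal ?_) _) hvol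
  rw [finrank_euclideanSpace_fin, abs_mul, abs_of_pos (pow_pos hs0 n)]
  refine mul_le_mul_of_nonneg_left ?_ (pow_pos hs0 n).le
  rw [PiLp.smul_apply, smul_eq_mul, abs_mul, abs_of_pos (by positivity : 0 < 2 * n / η)]
  calc 2 * d / η = 2 * n / η * (d / n) := by field_simp
    _ ≤ _ := mul_le_mul_of_nonneg_left hi₀ (by positivity)

end PolarVolume

section Aleksandrov

variable {n : ℕ}

/-- Slopes staying below the depth of the section `{v ≤ ⟪b, ·⟫ + c}` at `p` come from
subgradients of `v` inside the section. -/
theorem slopes_subset_subgradImg {Ω N : Set (EuclideanSpace ℝ (Fin n))}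
    {v : EuclideanSpace ℝ (Fin n) → ℝ} (hcont : ContinuousOn v Ω) (hconv : ConvexOn ℝ Ω v)
    (hN : IsCompact N) (hNΩ : N ⊆ Ω) {b p : EuclideanSpace ℝ (Fin n)} {c ε : ℝ}
    (hbd : ∀ x ∈ N, v x ≤ ⟪b, x⟫ + c → x ∈ interior N)
    (hp : p ∈ N) (hε : 0 < ε) (hpε : v p ≤ ⟪b, p⟫ + c - ε) :
    (fun a => b + a) '' {a : EuclideanSpace ℝ (Fin n) |
        ∀ x ∈ {x ∈ N | v x ≤ ⟪b, x⟫ + c}, ⟪a, x - p⟫ < ε} ⊆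
      subgradImg Ω v {x ∈ N | v x ≤ ⟪b, x⟫ + c} := by
  rintro _ ⟨a, ha, rfl⟩
  have hvN : ContinuousOn v N := hcont.mono hNΩ
  have hScpt : IsCompact {x ∈ N | v x ≤ ⟪b, x⟫ + c} :=
    hN.of_isClosed_subset (hN.isClosed.isClosed_le hvN (by fun_prop)) (fun x hx => hx.1)
  have hpS : p ∈ {x ∈ N | v x ≤ ⟪b, x⟫ + c} := ⟨hp, by linarith⟩
  obtain ⟨z, hzS, hzmin⟩ := hScpt.exists_isMinOn (f := fun x => v x - ⟪b + a, x⟫) ⟨p, hpS⟩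
    ((hvN.mono fun x hx => hx.1).sub (by fun_prop))
  have hzlt : v z < ⟪b, z⟫ + c := by
    have h1 : v z - ⟪b + a, z⟫ ≤ v p - ⟪b + a, p⟫ := hzmin hpS
    have h2 := ha z hzS
    rw [inner_sub_right] at h2
    simp only [inner_add_left] at h1
    linarith
  have hzint := hbd z hzS.1 hzS.2
  have hnhds : {x ∈ N | v x ≤ ⟪b, x⟫ + c} ∈ nhds z := by
    have h1 : N ∈ nhds z := mem_interior_iff_mem_nhds.1 hzint
    have h2 : ContinuousAt v z := hvN.continuousAt h1
    have h3 : ∀ᶠ x in nhds z, v x < ⟪b, x⟫ + c :=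
      h2.eventually_lt (by fun_prop) hzlt
    filter_upwards [h1, h3] with x hx hx' using ⟨hx, hx'.le⟩
  have hconv' : ConvexOn ℝ Ω fun x => v x - ⟪b + a, x⟫ := by
    refine hconv.sub ?_
    exact (innerSL ℝ (b + a)).toLinearMap.concaveOn hconv.1
  have hmin : IsMinOn (fun x => v x - ⟪b + a, x⟫) Ω z :=
    IsMinOn.of_isLocalMinOn_of_convexOn (hNΩ hzS.1)
      ((hzmin.isLocalMin hnhds).on Ω) hconv'
  refine mem_iUnion₂.2 ⟨z, hzS, fun y hy => ?_⟩
  have := hmin hy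
  simp only [mem_ofPred_eq] at this
  rw [inner_sub_right]
  linarith

end Aleksandrov

section Nondegeneracy

variable {n : ℕ}

/-- The diagonal linear map with entries `d`. -/
def diagMap (d : Fin n → ℝ) : EuclideanSpace ℝ (Fin n) →ₗ[ℝ] EuclideanSpace ℝ (Fin n) where
  toFun x := WithLp.toLp 2 fun i => d i * x i
  map_add' x y := by ext i; simp [mul_add]
  map_smul' r x := by ext i; simp [mul_left_comm]

theorem det_diagMap (d : Fin n → ℝ) : LinearMap.det (diagMap d) = ∏ i, d i := by
  rw [← LinearMap.det_toMatrix (EuclideanSpace.basisFun (Fin n) ℝ).toBasis, ← Matrix.det_diagonal]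
  congr 1
  ext i j
  by_cases hij : i = j
  · subst hij; simp [LinearMap.toMatrix_apply, diagMap]
  · simp [LinearMap.toMatrix_apply, diagMap, hij]

/-- The gradient of the barrier `A ∑ tᵢ ^ (2 k)`. -/
def barrierGrad (A : ℝ) (k : ℕ) (t : EuclideanSpace ℝ (Fin n)) : EuclideanSpace ℝ (Fin n) :=
  WithLp.toLp 2 fun i => A * ((2 * k : ℕ) * t i ^ (2 * k - 1))

theorem hasFDerivAt_barrierGrad (A : ℝ) (k : ℕ) (t : EuclideanSpace ℝ (Fin n)) :
    HasFDerivAt (barrierGrad A k) (LinearMap.toContinuousLinearMap (diagMap fun i =>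
      A * ((2 * k : ℕ) * ((2 * k - 1 : ℕ) * t i ^ (2 * k - 1 - 1))))) t := by
  rw [← hasFDerivWithinAt_univ, hasFDerivWithinAt_euclidean]
  intro i
  rw [hasFDerivWithinAt_univ]
  have h1 : HasFDerivAt (fun t : EuclideanSpace ℝ (Fin n) => t i)
      (EuclideanSpace.proj i : EuclideanSpace ℝ (Fin n) →L[ℝ] ℝ) t :=
    (EuclideanSpace.proj i : EuclideanSpace ℝ (Fin n) →L[ℝ] ℝ).hasFDerivAt
  have h2 := ((h1.pow (2 * k - 1)).const_mul ((2 * k : ℕ) : ℝ)).const_mul A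
  refine h2.congr_fderiv ?_
  ext y
  simp [diagMap]
  ring

theorem hasFDerivAt_barrier (A : ℝ) (k : ℕ) (t : EuclideanSpace ℝ (Fin n)) :
    HasFDerivAt (fun t : EuclideanSpace ℝ (Fin n) => A * ∑ i, t i ^ (2 * k))
      (innerSL ℝ (barrierGrad A k t)) t := by
  have h1 : ∀ i, HasFDerivAt (fun t : EuclideanSpace ℝ (Fin n) => t i)
      (EuclideanSpace.proj i : EuclideanSpace ℝ (Fin n) →L[ℝ] ℝ) t := fun i =>
    (EuclideanSpace.proj i : EuclideanSpace ℝ (Fin n) →L[ℝ] ℝ).hasFDerivAt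
  have h2 := (HasFDerivAt.fun_sum fun i (_ : i ∈ Finset.univ) => (h1 i).pow (2 * k)).const_mul A
  refine h2.congr_fderiv ?_
  ext y
  simp [inner_eq_sum, barrierGrad, Finset.mul_sum]
  refine Finset.sum_congr rfl fun i _ => by ring

/-- The Hessian determinant of the barrier is controlled by a power of the barrier. -/
theorem prod_barrier_le {q A C : ℝ} (hn : 0 < n) (hq0 : 0 ≤ q) {k : ℕ} (hk : 1 ≤ k)
    (hkn : (n : ℝ) ≤ k * (n - q)) (hA : 0 < A) (hC : 0 ≤ C) {t : EuclideanSpace ℝ (Fin n)}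
    (ht : ∀ i, |t i| ≤ 1) :
    ∏ i, |A * (C * t i ^ (2 * k - 1 - 1))| ≤
      A ^ (n - q) * C ^ n * (A * ∑ i, t i ^ (2 * k)) ^ q := by
  have : Nonempty (Fin n) := ⟨⟨0, hn⟩⟩
  obtain ⟨i₀, hi₀⟩ := Finite.exists_max fun i => |t i|
  set m := |t i₀| with hm
  have hm0 : 0 ≤ m := abs_nonneg _
  have h1 : ∏ i, |A * (C * t i ^ (2 * k - 1 - 1))| ≤ ∏ _i : Fin n, A * (C * m ^ (2 * k - 2)) := by
    refine Finset.prod_le_prod (fun i _ => abs_nonneg _) fun i _ => ?_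
    rw [abs_mul, abs_mul, abs_of_pos hA, abs_of_nonneg hC, abs_pow, Nat.sub_sub]
    gcongr
    exact hi₀ i
  refine h1.trans ?_
  rw [Finset.prod_const, Finset.card_univ, Fintype.card_fin]
  have h2 : A * m ^ (2 * k) ≤ A * ∑ i, t i ^ (2 * k) := by
    refine mul_le_mul_of_nonneg_left ?_ hA.le
    have : m ^ (2 * k) = t i₀ ^ (2 * k) := by rw [hm, pow_mul, sq_abs, ← pow_mul]
    rw [this]
    exact Finset.single_le_sum (f := fun i => t i ^ (2 * k))
      (fun i _ => (even_two_mul k).pow_nonneg _) (Finset.mem_univ i₀)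
  have h3 : (m ^ (2 * k - 2)) ^ n ≤ (m ^ (2 * k)) ^ q := by
    rcases eq_or_lt_of_le hm0 with h0 | h0
    · rw [← h0]
      rcases Nat.eq_or_lt_of_le hk with hk1 | hk1
      · have hq : q = 0 := by
          rw [← hk1] at hkn; push_cast at hkn; linarith
        simp [hq, ← hk1]
      · rw [zero_pow (by omega : 2 * k - 2 ≠ 0), zero_pow hn.ne']
        positivity
    · rw [← pow_mul, ← Real.rpow_natCast, ← Real.rpow_natCast, ← Real.rpow_mul hm0]
      refine Real.rpow_le_rpow_of_exponent_ge h0 (ht i₀) ?_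
      have : ((2 * k - 2 : ℕ) : ℝ) = 2 * k - 2 := by
        rw [Nat.cast_sub (by omega)]; push_cast; ring
      push_cast [this]
      nlinarith
  calc (A * (C * m ^ (2 * k - 2))) ^ n = A ^ (n : ℝ) * C ^ n * (m ^ (2 * k - 2)) ^ n := by
        rw [Real.rpow_natCast]; ring
    _ ≤ A ^ (n : ℝ) * C ^ n * (m ^ (2 * k)) ^ q := by gcongr
    _ = A ^ (n - q) * C ^ n * (A * m ^ (2 * k)) ^ q := by
        rw [Real.mul_rpow hA.le (by positivity)]
        have : A ^ (n : ℝ) = A ^ (n - q) * A ^ q := by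
          rw [← Real.rpow_add hA]; congr 1; ring
        rw [this]; ring
    _ ≤ _ := by gcongr

theorem norm_le_sqrt_of_abs_le_one {t : EuclideanSpace ℝ (Fin n)} (ht : ∀ i, |t i| ≤ 1) :
    ‖t‖ ≤ √n := by
  rw [EuclideanSpace.norm_eq]
  refine Real.sqrt_le_sqrt ?_
  calc ∑ i, ‖t i‖ ^ 2 ≤ ∑ _i : Fin n, (1 : ℝ) := Finset.sum_le_sum fun i _ => by
        rw [Real.norm_eq_abs]; exact pow_le_one₀ (abs_nonneg _) (ht i)
    _ = n := by simp

/-- Contact points of a barrier with a function `v`: each subgradient of `v` at a point where `v`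
exceeds the barrier is a slope of the barrier at another such point. -/
theorem subgradImg_barrier_subset {Ω : Set (EuclideanSpace ℝ (Fin n))}
    {v : EuclideanSpace ℝ (Fin n) → ℝ} {A : ℝ} (hA : 0 < A) (k : ℕ)
    (x₀ : EuclideanSpace ℝ (Fin n)) (M : EuclideanSpace ℝ (Fin n) ≃ₗ[ℝ] EuclideanSpace ℝ (Fin n))
    (hΩ : ∀ t : EuclideanSpace ℝ (Fin n), (∀ i, |t i| ≤ 1) → x₀ + M t ∈ Ω ∧ v (x₀ + M t) < A) :
    subgradImg Ω v {x | (∀ i, |M.symm (x - x₀) i| < 1) ∧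
        A * ∑ i, M.symm (x - x₀) i ^ (2 * k) < v x} ⊆
      (fun x => LinearMap.adjoint M.symm.toLinearMap (barrierGrad A k (M.symm (x - x₀)))) ''
        {x | (∀ i, |M.symm (x - x₀) i| < 1) ∧ A * ∑ i, M.symm (x - x₀) i ^ (2 * k) < v x} := by
  intro a ha
  obtain ⟨x, hx, hax⟩ := mem_iUnion₂.1 ha
  set Q : Set (EuclideanSpace ℝ (Fin n)) := {t | ∀ i, |t i| ≤ 1} with hQ
  have hQcpt : IsCompact Q := by
    have hcl : IsClosed Q := by
      have : Q = ⋂ i, {t : EuclideanSpace ℝ (Fin n) | |t i| ≤ 1} := by ext; simp [hQ]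
      rw [this]
      exact isClosed_iInter fun i => isClosed_le (by fun_prop) continuous_const
    refine Metric.isCompact_of_isClosed_isBounded hcl
      ((Metric.isBounded_iff_subset_closedBall 0).2 ⟨√n, fun t ht => ?_⟩)
    exact mem_closedBall_zero_iff.2 (norm_le_sqrt_of_abs_le_one ht)
  set Φ : EuclideanSpace ℝ (Fin n) → ℝ := fun t => A * ∑ i, t i ^ (2 * k) with hΦ
  have hlin : Continuous fun t => M t := LinearMap.continuous_of_finiteDimensional M.toLinearMap
  obtain ⟨s, hsQ, hs⟩ := hQcpt.exists_isMinOn (f := fun t => Φ t - ⟪a, M t⟫)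
    ⟨M.symm (x - x₀), fun i => (hx.1 i).le⟩ (by simp only [hΦ]; fun_prop)
  have hsub := hax (x₀ + M s) (hΩ s hsQ).1
  have hsm : Φ s - ⟪a, M s⟫ ≤ Φ (M.symm (x - x₀)) - ⟪a, M (M.symm (x - x₀))⟫ :=
    hs (show M.symm (x - x₀) ∈ Q from fun i => (hx.1 i).le)
  have hxv : Φ (M.symm (x - x₀)) < v x := hx.2
  have hΦs : Φ s < v (x₀ + M s) := by
    rw [LinearEquiv.apply_symm_apply] at hsm
    have : x₀ + M s - x = M s - (x - x₀) := by abel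
    rw [this, inner_sub_right] at hsub
    linarith
  have hs1 : ∀ i, |s i| < 1 := by
    intro i
    refine lt_of_le_of_ne (hsQ i) fun h1 => ?_
    have h2 : s i ^ (2 * k) ≤ ∑ j, s j ^ (2 * k) :=
      Finset.single_le_sum (f := fun j => s j ^ (2 * k))
        (fun j _ => (even_two_mul k).pow_nonneg _) (Finset.mem_univ i)
    have h3 : s i ^ (2 * k) = 1 := by rw [pow_mul, ← sq_abs, h1]; simp
    have h4 := (hΩ s hsQ).2
    have h5 : A * 1 ≤ Φ s := mul_le_mul_of_nonneg_left (by rw [← h3]; exact h2) hA.le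
    linarith
  have hnhds : Q ∈ nhds s := by
    have : {t : EuclideanSpace ℝ (Fin n) | ∀ i, |t i| < 1} ∈ nhds s := by
      have h0 : {t : EuclideanSpace ℝ (Fin n) | ∀ i, |t i| < 1} =
          ⋂ i, {t : EuclideanSpace ℝ (Fin n) | |t i| < 1} := by ext; simp
      rw [h0]
      exact (isOpen_iInter_of_finite fun i =>
        isOpen_lt (by fun_prop) continuous_const).mem_nhds (by simpa using hs1)
    exact Filter.mem_of_superset this fun t ht i => (ht i).le
  have hderiv : HasFDerivAt (fun t => Φ t - ⟪a, M t⟫)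
      (innerSL ℝ (barrierGrad A k s) -
        (innerSL ℝ a).comp (LinearMap.toContinuousLinearMap M.toLinearMap)) s :=
    (hasFDerivAt_barrier A k s).sub
      ((innerSL ℝ a).comp (LinearMap.toContinuousLinearMap M.toLinearMap)).hasFDerivAt
  have hzero := (hs.isLocalMin hnhds).hasFDerivAt_eq_zero hderiv
  have hgrad : barrierGrad A k s = LinearMap.adjoint M.toLinearMap a := by
    refine ext_inner_right ℝ fun y => ?_
    have := DFunLike.congr_fun hzero y
    rw [LinearMap.adjoint_inner_left]
    simp only [sub_apply, innerSL_apply_apply, ContinuousLinearMap.comp_apply,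
      LinearMap.coe_toContinuousLinearMap', _root_.zero_apply] at this
    linarith
  refine ⟨x₀ + M s, ⟨?_, ?_⟩, ?_⟩
  · simpa using hs1
  · simpa [hΦ] using hΦs
  · simp only [add_sub_cancel_left, LinearEquiv.symm_apply_apply, hgrad]
    exact adjoint_symm_apply M.symm a

/-- Nondegeneracy: a function with `det D²v ≥ λ v^q` on `{v > 0}` and positive at the centre of
a parallelepiped cannot be too small on it. -/
theorem exists_nondegeneracy_const (hn : 0 < n) {q lam : ℝ} (hq0 : 0 ≤ q) (hqn : q < n)
    (hlam : 0 < lam) :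
    ∃ c > 0, ∀ (Ω : Set (EuclideanSpace ℝ (Fin n))) (v : EuclideanSpace ℝ (Fin n) → ℝ)
      (x₀ : EuclideanSpace ℝ (Fin n)) (B : ℝ)
      (M : EuclideanSpace ℝ (Fin n) ≃ₗ[ℝ] EuclideanSpace ℝ (Fin n)),
      ContinuousOn v Ω →
      (∀ E : Set (EuclideanSpace ℝ (Fin n)), MeasurableSet E → E ⊆ Ω →
        ENNReal.ofReal lam * ∫⁻ x in E ∩ {x | 0 < v x}, ENNReal.ofReal (v x ^ q) ≤
          volume (subgradImg Ω v (E ∩ {x | 0 < v x}))) →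
      0 < v x₀ →
      (∀ t : EuclideanSpace ℝ (Fin n), (∀ i, |t i| ≤ 1) → x₀ + M t ∈ Ω ∧ v (x₀ + M t) ≤ B) →
      c * |LinearMap.det M.toLinearMap| ^ 2 ≤ B ^ ((n : ℝ) - q) := by
  have hnq : 0 < (n : ℝ) - q := sub_pos.2 hqn
  obtain ⟨k₀, hk₀⟩ := exists_nat_ge ((n : ℝ) / (n - q))
  set k := k₀ + 1 with hkdef
  have hk : 1 ≤ k := by omega
  have hkn : (n : ℝ) ≤ k * (n - q) := by
    rw [div_le_iff₀ hnq] at hk₀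
    rw [hkdef]; push_cast; nlinarith
  set C : ℝ := (2 * k : ℕ) * (2 * k - 1 : ℕ) with hCdef
  have hC : 0 < C := by
    have h1 : 0 < 2 * k := by omega
    have h2 : 0 < 2 * k - 1 := by omega
    rw [hCdef]; positivity
  refine ⟨lam / (2 * C ^ n), by positivity, ?_⟩
  intro Ω v x₀ B M hcont hlow hx₀ hΩ
  by_contra! hlt
  set D := |LinearMap.det M.toLinearMap| with hD
  have hD0 : 0 < D := abs_pos.2 (LinearEquiv.isUnit_det' M).ne_zero
  set R := lam / (2 * C ^ n) * D ^ 2 with hR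
  have hR0 : 0 < R := by positivity
  set A := R ^ (1 / ((n : ℝ) - q)) with hAdef
  have hA : 0 < A := Real.rpow_pos_of_pos hR0 _
  have hAR : A ^ ((n : ℝ) - q) = R := by
    rw [hAdef, ← Real.rpow_mul hR0.le, one_div_mul_cancel hnq.ne', Real.rpow_one]
  have hB0 : 0 < B := by
    have := (hΩ 0 (by simp)).2
    simp only [map_zero, add_zero] at this
    linarith
  have hBA : B < A := by
    rw [← hAR] at hlt
    exact (Real.rpow_lt_rpow_iff hB0.le hA.le hnq).1 hlt
  set G := {x | (∀ i, |M.symm (x - x₀) i| < 1) ∧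
        A * ∑ i, M.symm (x - x₀) i ^ (2 * k) < v x} with hG
  have hsymm : Continuous fun x => M.symm x :=
    LinearMap.continuous_of_finiteDimensional M.symm.toLinearMap
  have hGΩ : G ⊆ Ω := fun x hx => by
    have := (hΩ (M.symm (x - x₀)) fun i => (hx.1 i).le).1
    simpa using this
  have hGpos : ∀ x ∈ G, 0 < v x := fun x hx => by
    refine lt_of_le_of_lt ?_ hx.2
    exact mul_nonneg hA.le (Finset.sum_nonneg fun j _ => (even_two_mul k).pow_nonneg _)
  have hGB : ∀ x ∈ G, v x ≤ B := fun x hx => by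
    have := (hΩ (M.symm (x - x₀)) fun i => (hx.1 i).le).2
    simpa using this
  have hPopen : IsOpen {x : EuclideanSpace ℝ (Fin n) | ∀ i, |M.symm (x - x₀) i| < 1} := by
    have h0 : {x : EuclideanSpace ℝ (Fin n) | ∀ i, |M.symm (x - x₀) i| < 1} =
          ⋂ i, {x : EuclideanSpace ℝ (Fin n) | |M.symm (x - x₀) i| < 1} := by ext; simp
    rw [h0]
    exact isOpen_iInter_of_finite fun i => isOpen_lt (by fun_prop) continuous_const
  have hGopen : IsOpen G := by
    have hc : ContinuousOn (fun x => v x - A * ∑ i, M.symm (x - x₀) i ^ (2 * k))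
        {x : EuclideanSpace ℝ (Fin n) | ∀ i, |M.symm (x - x₀) i| < 1} := by
      refine (hcont.mono fun x hx => ?_).sub (by fun_prop)
      have := (hΩ (M.symm (x - x₀)) fun i => (hx i).le).1
      simpa using this
    have h1 := hc.isOpen_inter_preimage hPopen isOpen_Ioi (t := Ioi 0)
    convert h1 using 1
    ext x
    simp [hG]
  have hx₀G : x₀ ∈ G := by
    have : 0 < 2 * k := by omega
    simp [hG, this.ne', hx₀]
  have hGmeas := hGopen.measurableSet
  have hGinter : G ∩ {x | 0 < v x} = G := inter_eq_left.2 hGpos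
  have hlower := hlow G hGmeas hGΩ
  rw [hGinter] at hlower
  set I := ∫⁻ x in G, ENNReal.ofReal (v x ^ q) with hI
  have hupper : volume (subgradImg Ω v G) ≤ ENNReal.ofReal (lam / 2) * I := by
    refine (measure_mono (subgradImg_barrier_subset hA k x₀ M fun t ht =>
      ⟨(hΩ t ht).1, (hΩ t ht).2.trans_lt hBA⟩)).trans ?_
    have hder : ∀ x ∈ G, HasFDerivWithinAt
        (fun x => LinearMap.adjoint M.symm.toLinearMap (barrierGrad A k (M.symm (x - x₀))))
        ((LinearMap.toContinuousLinearMap (LinearMap.adjoint M.symm.toLinearMap)).comp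
          ((LinearMap.toContinuousLinearMap (diagMap fun i =>
            A * ((2 * k : ℕ) * ((2 * k - 1 : ℕ) * M.symm (x - x₀) i ^ (2 * k - 1 - 1))))).comp
            (LinearMap.toContinuousLinearMap M.symm.toLinearMap))) G x := by
      intro x _
      have h1 : HasFDerivAt (fun x => M.symm (x - x₀))
          (LinearMap.toContinuousLinearMap M.symm.toLinearMap) x :=
        (LinearMap.toContinuousLinearMap M.symm.toLinearMap).hasFDerivAt.comp x
          (hasFDerivAt_sub_const x₀)
      have h2 := (hasFDerivAt_barrierGrad A k (M.symm (x - x₀))).comp x h1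
      exact ((LinearMap.toContinuousLinearMap
        (LinearMap.adjoint M.symm.toLinearMap)).hasFDerivAt.comp x h2).hasFDerivWithinAt
    refine (addHaar_image_le_lintegral_abs_det_fderiv volume hGmeas hder).trans ?_
    rw [hI, ← lintegral_const_mul' _ _ ENNReal.ofReal_ne_top]
    refine setLIntegral_mono' hGmeas fun x hx => ?_
    rw [← ENNReal.ofReal_mul (by positivity)]
    refine ENNReal.ofReal_le_ofReal ?_
    have hdetsymm : LinearMap.det M.symm.toLinearMap = (LinearMap.det M.toLinearMap)⁻¹ :=
      LinearEquiv.det_coe_symm M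
    have hdet : |((LinearMap.toContinuousLinearMap (LinearMap.adjoint M.symm.toLinearMap)).comp
          ((LinearMap.toContinuousLinearMap (diagMap fun i =>
            A * ((2 * k : ℕ) * ((2 * k - 1 : ℕ) * M.symm (x - x₀) i ^ (2 * k - 1 - 1))))).comp
            (LinearMap.toContinuousLinearMap M.symm.toLinearMap))).det| =
        (D ^ 2)⁻¹ * ∏ i, |A * (C * M.symm (x - x₀) i ^ (2 * k - 1 - 1))| := by
      have : |((LinearMap.toContinuousLinearMap (LinearMap.adjoint M.symm.toLinearMap)).comp
          ((LinearMap.toContinuousLinearMap (diagMap fun i =>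
            A * ((2 * k : ℕ) * ((2 * k - 1 : ℕ) * M.symm (x - x₀) i ^ (2 * k - 1 - 1))))).comp
            (LinearMap.toContinuousLinearMap M.symm.toLinearMap))).det| =
          |LinearMap.det (LinearMap.adjoint M.symm.toLinearMap ∘ₗ ((diagMap fun i =>
            A * ((2 * k : ℕ) * ((2 * k - 1 : ℕ) * M.symm (x - x₀) i ^ (2 * k - 1 - 1)))) ∘ₗ
              M.symm.toLinearMap))| := rfl
      rw [this, LinearMap.det_comp, LinearMap.det_comp, det_adjoint_eq, det_diagMap, hdetsymm,
        abs_mul, abs_mul, abs_inv, ← hD, Finset.abs_prod]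
      simp only [hCdef, mul_assoc]
      field_simp
    rw [hdet]
    have h3 := prod_barrier_le hn hq0 hk hkn hA hC.le (t := M.symm (x - x₀)) fun i => (hx.1 i).le
    have h4 : (A * ∑ i, M.symm (x - x₀) i ^ (2 * k)) ^ q ≤ v x ^ q := by
      refine Real.rpow_le_rpow ?_ hx.2.le hq0
      exact mul_nonneg hA.le (Finset.sum_nonneg fun j _ => (even_two_mul k).pow_nonneg _)
    calc (D ^ 2)⁻¹ * ∏ i, |A * (C * M.symm (x - x₀) i ^ (2 * k - 1 - 1))|
        ≤ (D ^ 2)⁻¹ * (A ^ (n - q) * C ^ n * v x ^ q) := by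
          refine mul_le_mul_of_nonneg_left (h3.trans ?_) (by positivity)
          exact mul_le_mul_of_nonneg_left h4 (by positivity)
      _ = lam / 2 * v x ^ q := by
          rw [hAR, hR]
          field_simp
  have hItop : I ≠ ⊤ := by
    have hGbdd : volume G ≠ ⊤ := by
      have hsub : G ⊆ (fun y => x₀ + y) '' (M.toLinearMap '' closedBall 0 √n) := by
        intro x hx
        refine ⟨x - x₀, ⟨M.symm (x - x₀), ?_, by simp⟩, by simp⟩
        exact mem_closedBall_zero_iff.2 (norm_le_sqrt_of_abs_le_one fun i => (hx.1 i).le)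
      have hcpt : IsCompact ((fun y => x₀ + y) '' (M.toLinearMap '' closedBall 0 √n)) :=
        ((isCompact_closedBall _ _).image
          (LinearMap.continuous_of_finiteDimensional _)).image (by fun_prop)
      exact ((measure_mono hsub).trans_lt hcpt.measure_lt_top).ne
    have h1 : I ≤ ∫⁻ _ in G, ENNReal.ofReal (B ^ q) :=
      setLIntegral_mono' hGmeas fun x hx => ENNReal.ofReal_le_ofReal
        (Real.rpow_le_rpow (hGpos x hx).le (hGB x hx) hq0)
    rw [setLIntegral_const] at h1
    exact (h1.trans_lt (ENNReal.mul_lt_top ENNReal.ofReal_lt_top hGbdd.lt_top)).ne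
  have hI0 : I ≠ 0 := by
    intro h0
    have hmeas : AEMeasurable (fun x => ENNReal.ofReal (v x ^ q)) (volume.restrict G) := by
      have : AEMeasurable v (volume.restrict G) := (hcont.mono hGΩ).aemeasurable hGmeas
      exact (this.pow_const q).ennreal_ofReal
    rw [hI, lintegral_eq_zero_iff' hmeas, Filter.EventuallyEq, ae_restrict_iff' hGmeas] at h0
    have h1 : volume G = 0 := by
      refine measure_mono_null (fun x hx => ?_) h0
      simp only [mem_compl_iff, mem_ofPred_eq, Pi.zero_apply, ENNReal.ofReal_eq_zero, not_forall,
        not_le]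
      exact ⟨hx, Real.rpow_pos_of_pos (hGpos x hx) q⟩
    exact (hGopen.measure_pos volume ⟨x₀, hx₀G⟩).ne' h1
  have h1 := hlower.trans hupper
  rw [ENNReal.mul_le_mul_iff_left hI0 hItop] at h1
  rw [ENNReal.ofReal_le_ofReal_iff (by positivity)] at h1
  linarith

end Nondegeneracy

section SectionRatio

variable {n : ℕ}

theorem isCompact_section {Ω N : Set (EuclideanSpace ℝ (Fin n))}
    {v : EuclideanSpace ℝ (Fin n) → ℝ} (hcont : ContinuousOn v Ω) (hN : IsCompact N)
    (hNΩ : N ⊆ Ω) (b : EuclideanSpace ℝ (Fin n)) (c : ℝ) :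
    IsCompact {x ∈ N | v x ≤ ⟪b, x⟫ + c} :=
  hN.of_isClosed_subset (hN.isClosed.isClosed_le (hcont.mono hNΩ) (by fun_prop)) fun _ hx => hx.1

theorem convex_section {Ω N : Set (EuclideanSpace ℝ (Fin n))}
    {v : EuclideanSpace ℝ (Fin n) → ℝ} (hconv : ConvexOn ℝ Ω v) (hN : Convex ℝ N)
    (hNΩ : N ⊆ Ω) (b : EuclideanSpace ℝ (Fin n)) (c : ℝ) :
    Convex ℝ {x ∈ N | v x ≤ ⟪b, x⟫ + c} := by
  have h1 : ConvexOn ℝ N fun x => v x - ⟪b, x⟫ :=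
    (hconv.subset hNΩ hN).sub ((innerSL ℝ b).toLinearMap.concaveOn hN)
  convert h1.convex_le c using 1
  ext x
  simp [add_comm]

theorem add_map_mem_of_convex {S : Set (EuclideanSpace ℝ (Fin n))} (hS : Convex ℝ S)
    {p : EuclideanSpace ℝ (Fin n)} (hp : p ∈ S)
    (M : EuclideanSpace ℝ (Fin n) →ₗ[ℝ] EuclideanSpace ℝ (Fin n))
    (hM : ∀ i, p + M (EuclideanSpace.single i 1) ∈ S) {s : EuclideanSpace ℝ (Fin n)}
    (hs0 : ∀ i, 0 ≤ s i) (hs1 : ∑ i, s i ≤ 1) : p + M s ∈ S := by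
  have h1 := hS.sum_mem (t := Finset.univ) (w := fun o : Option (Fin n) =>
      o.elim (1 - ∑ i, s i) fun i => s i)
    (z := fun o => o.elim p fun i => p + M (EuclideanSpace.single i 1))
    (by rintro (_ | i) _ <;> simp [hs0, hs1]) (by simp [Fintype.sum_option])
    (by rintro (_ | i) _ <;> simp [hp, hM])
  convert h1 using 1
  conv_lhs => rw [← sum_smul_single s]
  simp only [Fintype.sum_option, Option.elim, smul_add, Finset.sum_add_distrib, map_sum, map_smul,
    ← Finset.sum_smul, sub_smul, one_smul]
  abel

/-- Volume comparison for the section `{v ≤ ⟪b, ·⟫ + c}`: the Aleksandrov estimate. -/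
theorem aleksandrov_estimate (hn : 0 < n) {q lam Lam : ℝ} (hq0 : 0 ≤ q) (hLam : 0 ≤ Lam)
    {Ω N : Set (EuclideanSpace ℝ (Fin n))} {v : EuclideanSpace ℝ (Fin n) → ℝ}
    (hv : GenSol n q lam Lam Ω v) (hN : IsCompact N) (hNΩ : N ⊆ Ω)
    {b p p₂ ξ : EuclideanSpace ℝ (Fin n)} {c ε η d B : ℝ}
    (hbd : ∀ x ∈ N, v x ≤ ⟪b, x⟫ + c → x ∈ interior N)
    (hp : p ∈ N) (hε : 0 < ε) (hpε : v p ≤ ⟪b, p⟫ + c - ε) (hη : 0 < η) (hd : 0 < d)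
    (M : EuclideanSpace ℝ (Fin n) ≃ₗ[ℝ] EuclideanSpace ℝ (Fin n))
    (hM : ∀ x ∈ {x ∈ N | v x ≤ ⟪b, x⟫ + c}, ∀ i, |M.symm (x - p) i| ≤ 1)
    (hB : ∀ x ∈ {x ∈ N | v x ≤ ⟪b, x⟫ + c}, v x ≤ B)
    (hξ : ∀ x ∈ {x ∈ N | v x ≤ ⟪b, x⟫ + c}, ⟪ξ, x - p⟫ ≤ η)
    (hp₂ : p₂ ∈ {x ∈ N | v x ≤ ⟪b, x⟫ + c}) (hξp₂ : ⟪ξ, p₂ - p⟫ ≤ -d) :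
    (ε / (4 * n)) ^ n * (2 * d / η) * (volume (unitCube n)).toReal ≤
      |LinearMap.det M.toLinearMap| ^ 2 * Lam * B ^ q *
        (volume (closedBall (0 : EuclideanSpace ℝ (Fin n)) √n)).toReal := by
  set S := {x ∈ N | v x ≤ ⟪b, x⟫ + c} with hS
  set D := |LinearMap.det M.toLinearMap| with hD
  have hScpt : IsCompact S := isCompact_section hv.1 hN hNΩ b c
  have hSΩ : S ⊆ Ω := fun x hx => hNΩ hx.1
  have hB0 : 0 ≤ B := (hv.2.2.1 p (hNΩ hp)).trans (hB p ⟨hp, by linarith⟩)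
  have h1 := volume_slopes_ge hn M hε hη hd hM hξ hp₂ hξp₂
  have h2 : volume {a : EuclideanSpace ℝ (Fin n) | ∀ x ∈ S, ⟪a, x - p⟫ < ε} ≤
      volume (subgradImg Ω v S) := by
    rw [← measure_vadd volume b]
    exact measure_mono (slopes_subset_subgradImg hv.1 hv.2.1 hN hNΩ hbd hp hε hpε)
  have h3 := hv.2.2.2.1 S hScpt.measurableSet hSΩ
  have h4 : ∫⁻ x in S ∩ {x | 0 < v x}, ENNReal.ofReal (v x ^ q) ≤
      ENNReal.ofReal (B ^ q) * volume S := by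
    refine (lintegral_mono_set inter_subset_left).trans ?_
    rw [← setLIntegral_const]
    exact setLIntegral_mono' hScpt.measurableSet fun x hx => ENNReal.ofReal_le_ofReal
      (Real.rpow_le_rpow (hv.2.2.1 x (hSΩ hx)) (hB x hx) hq0)
  have h5 : volume S ≤ ENNReal.ofReal D *
      volume (closedBall (0 : EuclideanSpace ℝ (Fin n)) √n) := by
    rw [← Measure.addHaar_image_linearMap, ← measure_vadd volume p (M.toLinearMap '' _)]
    refine measure_mono fun x hx => ?_
    refine ⟨x - p, ⟨M.symm (x - p), ?_, by simp⟩, by simp⟩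
    exact mem_closedBall_zero_iff.2 (norm_le_sqrt_of_abs_le_one (hM x hx))
  have hfin : volume (closedBall (0 : EuclideanSpace ℝ (Fin n)) √n) ≠ ⊤ :=
    measure_closedBall_lt_top.ne
  have h6 : ENNReal.ofReal ((ε / (4 * n)) ^ n * (2 * d / η)) * volume (unitCube n) ≤
      ENNReal.ofReal D * (ENNReal.ofReal Lam * (ENNReal.ofReal (B ^ q) *
        (ENNReal.ofReal D * volume (closedBall (0 : EuclideanSpace ℝ (Fin n)) √n)))) := by
    refine h1.trans ?_
    gcongr
    refine h2.trans (h3.trans ?_)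
    gcongr
    refine h4.trans ?_
    gcongr
  have h7 := ENNReal.toReal_mono (by finiteness) h6
  have hD0 : 0 ≤ D := abs_nonneg _
  have hBq : 0 ≤ B ^ q := Real.rpow_nonneg hB0 q
  simp only [ENNReal.toReal_mul, ENNReal.toReal_ofReal hD0, ENNReal.toReal_ofReal hLam,
    ENNReal.toReal_ofReal hBq] at h7
  rw [ENNReal.toReal_ofReal (by positivity)] at h7
  calc _ ≤ _ := h7
    _ = _ := by ring

/-- A section that rises above the contact hyperplane is not thin near `p`: the ratio of the
extents of the section on the two sides of `p` in any direction is bounded. -/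
theorem exists_section_ratio_bound (hn : 0 < n) {q lam Lam : ℝ} (hq0 : 0 ≤ q) (hqn : q < n)
    (hlam : 0 < lam) (hLam : 0 ≤ Lam) {C : ℝ} (hC : 0 ≤ C) :
    ∃ Γ : ℝ, ∀ (Ω N : Set (EuclideanSpace ℝ (Fin n))) (v : EuclideanSpace ℝ (Fin n) → ℝ)
      (b p p₂ z a ξ : EuclideanSpace ℝ (Fin n)) (c ε η d Y : ℝ),
      GenSol n q lam Lam Ω v → IsCompact N → Convex ℝ N → N ⊆ Ω →
      (∀ x ∈ N, v x ≤ ⟪b, x⟫ + c → x ∈ interior N) →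
      p ∈ N → 0 < ε → v p ≤ ⟪b, p⟫ + c - ε → 0 < η → 0 < d → 0 < Y →
      (∀ x ∈ Ω, 0 < ⟪a, x - p⟫ → 0 < v x) →
      (∀ x ∈ {x ∈ N | v x ≤ ⟪b, x⟫ + c}, v x ≤ (C + 1) * ε) →
      (∀ x ∈ {x ∈ N | v x ≤ ⟪b, x⟫ + c}, -(C * Y) ≤ ⟪a, x - p⟫) →
      (∀ x ∈ {x ∈ N | v x ≤ ⟪b, x⟫ + c}, ⟪ξ, x - p⟫ ≤ η) →
      z ∈ {x ∈ N | v x ≤ ⟪b, x⟫ + c} → ⟪a, z - p⟫ = Y →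
      p₂ ∈ {x ∈ N | v x ≤ ⟪b, x⟫ + c} → ⟪ξ, p₂ - p⟫ ≤ -d →
      d / η ≤ Γ := by
  obtain ⟨c₂, hc₂, hnondeg⟩ := exists_nondegeneracy_const hn hq0 hqn hlam
  have hn' : (0 : ℝ) < n := Nat.cast_pos.2 hn
  set κ₁ := (volume (unitCube n)).toReal with hκ₁
  set κ₂ := (volume (closedBall (0 : EuclideanSpace ℝ (Fin n)) √n)).toReal with hκ₂
  have hκ₂0 : 0 ≤ κ₂ := ENNReal.toReal_nonneg
  have hκ₁0 : 0 < κ₁ := by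
    refine ENNReal.toReal_pos volume_unitCube_pos.ne' ?_
    have hsub : unitCube n ⊆ closedBall (0 : EuclideanSpace ℝ (Fin n)) √n := fun t ht =>
      mem_closedBall_zero_iff.2 (norm_le_sqrt_of_abs_le_one fun i =>
        abs_le.2 ⟨by linarith [(ht i).1], (ht i).2.le⟩)
    exact ((measure_mono hsub).trans_lt measure_closedBall_lt_top).ne
  set θ := 1 / (C + 2) with hθ
  have hθ0 : 0 < θ := by positivity
  have hθ1 : θ ≤ 1 := by rw [hθ, div_le_one (by positivity)]; linarith
  have hθC : θ * (C + 2) = 1 := by rw [hθ]; field_simp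
  set μ := θ / (2 * n) with hμ
  have hμ0 : 0 < μ := by positivity
  refine ⟨Lam * κ₂ * (C + 1) ^ n * (4 * n) ^ n / (2 * κ₁ * c₂ * (μ ^ n) ^ 2), ?_⟩
  intro Ω N v b p p₂ z a ξ c ε η d Y hv hN hNconv hNΩ hbd hp hε hpε hη hd hY hapos hB hlow hξ hz
    hzY hp₂ hξp₂
  set S := {x ∈ N | v x ≤ ⟪b, x⟫ + c} with hS
  have hScpt : IsCompact S := isCompact_section hv.1 hN hNΩ b c
  have hSconv : Convex ℝ S := convex_section hv.2.1 hNconv hNΩ b c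
  have hpS : p ∈ S := ⟨hp, by linarith⟩
  have hSnhds : S ∈ nhds p := by
    have h1 : N ∈ nhds p := mem_interior_iff_mem_nhds.1 (hbd p hp hpS.2)
    have h2 : ContinuousAt v p := (hv.1.mono hNΩ).continuousAt h1
    have h3 : ∀ᶠ x in nhds p, v x < ⟪b, x⟫ + c :=
      h2.eventually_lt (by fun_prop) (by linarith)
    filter_upwards [h1, h3] with x hx hx' using ⟨hx, hx'.le⟩
  obtain ⟨r, hr, hrS⟩ := Metric.nhds_basis_closedBall.mem_iff.1 hSnhds
  obtain ⟨M, hMS, hMsymm⟩ := exists_inscribed_linearEquiv (S := (fun x => x - p) '' S)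
    (hScpt.image (by fun_prop)) hr (fun y hy => ⟨p + y, hrS (by simpa using hy), by simp⟩)
  have hMS' : ∀ i, p + M (EuclideanSpace.single i 1) ∈ S := fun i => by
    obtain ⟨x, hx, hxi⟩ := hMS i
    rw [← hxi]; simpa using hx
  have h1 := aleksandrov_estimate hn hq0 hLam hv hN hNΩ hbd hp hε hpε hη hd M
    (fun x hx i => hMsymm _ ⟨x, hx, rfl⟩ i) hB hξ hp₂ hξp₂
  set D := |LinearMap.det M.toLinearMap| with hD
  set u : EuclideanSpace ℝ (Fin n) := WithLp.toLp 2 fun _ => 1 / (2 * n) with hu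
  set M' := M.trans (LinearEquiv.smulOfNeZero ℝ (EuclideanSpace ℝ (Fin n)) μ hμ0.ne') with hM'
  set x₀ := (1 - θ) • z + θ • (p + M u) with hx₀
  have hcube : ∀ t : EuclideanSpace ℝ (Fin n), (∀ i, |t i| ≤ 1) → x₀ + M' t ∈ S := by
    intro t ht
    have h2 : p + M (u + (1 / (2 * n) : ℝ) • t) ∈ S := by
      have h4 : ∀ i, 0 ≤ (u + (1 / (2 * n) : ℝ) • t) i ∧
          (u + (1 / (2 * n) : ℝ) • t) i ≤ 1 / n := by
        intro i
        have h5 := abs_le.1 (ht i)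
        have h6 : (u + (1 / (2 * n) : ℝ) • t) i = (1 / (2 * n) : ℝ) * (1 + t i) := by
          simp [hu]; ring
        rw [h6]
        refine ⟨mul_nonneg (by positivity) (by linarith), ?_⟩
        calc (1 / (2 * n) : ℝ) * (1 + t i) ≤ (1 / (2 * n) : ℝ) * 2 :=
              mul_le_mul_of_nonneg_left (by linarith) (by positivity)
          _ = 1 / n := by field_simp
      refine add_map_mem_of_convex hSconv hpS M.toLinearMap hMS' (fun i => (h4 i).1) ?_
      calc ∑ i, (u + (1 / (2 * n) : ℝ) • t) i ≤ ∑ _i : Fin n, (1 / n : ℝ) :=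
            Finset.sum_le_sum fun i _ => (h4 i).2
        _ = 1 := by simp [hn'.ne']
    have h3 := hSconv hz h2 (sub_nonneg.2 hθ1) hθ0.le (by ring)
    convert h3 using 1
    have : M' t = μ • M t := rfl
    rw [hx₀, this, map_add, map_smul, hμ, ← add_assoc, smul_add, smul_add, smul_add, smul_smul]
    rw [show θ * (1 / (2 * n)) = θ / (2 * n) by ring]
    abel
  have hx₀pos : 0 < v x₀ := by
    have hx₀S : x₀ ∈ S := by simpa using hcube 0 (by simp)
    have huS : p + M u ∈ S := by
      refine add_map_mem_of_convex hSconv hpS M.toLinearMap hMS'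
        (fun i => by simp only [hu]; positivity) ?_
      simp only [hu, Finset.sum_const, Finset.card_univ, Fintype.card_fin, nsmul_eq_mul]
      rw [mul_one_div, div_le_one (by positivity)]; linarith
    refine hapos x₀ (hNΩ hx₀S.1) ?_
    have h4 : x₀ - p = (1 - θ) • (z - p) + θ • (p + M u - p) := by
      rw [hx₀]; module
    rw [h4, inner_add_right, inner_smul_right, inner_smul_right, hzY]
    have h5 := mul_le_mul_of_nonneg_left (hlow _ huS) hθ0.le
    have h6 : (1 - θ) * Y + θ * -(C * Y) = θ * Y := by
      linear_combination (-Y) * hθC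
    have h7 : 0 < θ * Y := by positivity
    linarith
  have h2 := hnondeg Ω v x₀ ((C + 1) * ε) M' hv.1 hv.2.2.2.2 hx₀pos fun t ht =>
    ⟨hNΩ (hcube t ht).1, hB _ (hcube t ht)⟩
  have hdet : |LinearMap.det M'.toLinearMap| = μ ^ n * D := by
    have : M'.toLinearMap = μ • M.toLinearMap := rfl
    rw [this, LinearMap.det_smul, finrank_euclideanSpace_fin, abs_mul, abs_of_pos (pow_pos hμ0 n)]
  rw [hdet] at h2
  have hCε : 0 < (C + 1) * ε := by positivity
  have hD2 : D ^ 2 ≤ ((C + 1) * ε) ^ ((n : ℝ) - q) / (c₂ * (μ ^ n) ^ 2) := by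
    rw [le_div_iff₀ (by positivity)]
    calc D ^ 2 * (c₂ * (μ ^ n) ^ 2) = c₂ * (μ ^ n * D) ^ 2 := by ring
      _ ≤ _ := h2
  have h3 : (ε / (4 * n)) ^ n * (2 * d / η) * κ₁ ≤
      ε ^ n * (Lam * κ₂ * (C + 1) ^ n / (c₂ * (μ ^ n) ^ 2)) := by
    refine h1.trans ?_
    have hq' : 0 ≤ ((C + 1) * ε) ^ q := Real.rpow_nonneg hCε.le q
    calc D ^ 2 * Lam * ((C + 1) * ε) ^ q * κ₂
        ≤ ((C + 1) * ε) ^ ((n : ℝ) - q) / (c₂ * (μ ^ n) ^ 2) * Lam * ((C + 1) * ε) ^ q * κ₂ := by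
          gcongr
      _ = (((C + 1) * ε) ^ ((n : ℝ) - q) * ((C + 1) * ε) ^ q) *
            (Lam * κ₂ / (c₂ * (μ ^ n) ^ 2)) := by ring
      _ = _ := by
          rw [← Real.rpow_add hCε, sub_add_cancel, Real.rpow_natCast, mul_pow]
          ring
  rw [le_div_iff₀ (by positivity)]
  have h4 : (ε / (4 * n)) ^ n * (2 * d / η) * κ₁ = ε ^ n * (2 * κ₁ * (d / η) / (4 * n) ^ n) := by
    rw [div_pow]; ring
  rw [h4] at h3
  have h5 := le_of_mul_le_mul_left h3 (pow_pos hε n)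
  rw [div_le_div_iff₀ (by positivity) (by positivity)] at h5
  calc _ = 2 * κ₁ * (d / η) * (c₂ * (μ ^ n) ^ 2) := by ring
    _ ≤ _ := h5
    _ = _ := by ring

end SectionRatio

section FlatFace

variable {n : ℕ}

/-- A contact face `{v = 0} ∩ {⟪a, · - p⟫ = 0}` of the coincidence set has no localized piece on
which the linear function `⟪ξ, · - p⟫` is maximal at `p` without being constant. -/
theorem false_of_localized_face (hn : 0 < n) {q lam Lam : ℝ} (hq0 : 0 ≤ q) (hqn : q < n)
    (hlam : 0 < lam) (hLam : 0 ≤ Lam) {Ω N : Set (EuclideanSpace ℝ (Fin n))}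
    {v : EuclideanSpace ℝ (Fin n) → ℝ} (hv : GenSol n q lam Lam Ω v) (hN : IsCompact N)
    (hNconv : Convex ℝ N) (hNΩ : N ⊆ Ω) {p p₂ a ξ : EuclideanSpace ℝ (Fin n)}
    (hp : p ∈ interior N) (hvp : v p = 0) (ha : a ≠ 0)
    (hK : ∀ x ∈ Ω, v x = 0 → ⟪a, x - p⟫ ≤ 0)
    (hface : ∀ x ∈ N, v x = 0 → ⟪a, x - p⟫ = 0 → ⟪ξ, x - p⟫ ≤ 0)
    (hfront : ∀ x ∈ frontier N, v x = 0 → ⟪a, x - p⟫ = 0 → ⟪ξ, x - p⟫ < -2)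
    (hp₂ : p₂ ∈ N) (hvp₂ : v p₂ = 0) (hap₂ : ⟪a, p₂ - p⟫ = 0) (hξp₂ : ⟪ξ, p₂ - p⟫ < 0)
    (hξp₂' : -1 ≤ ⟪ξ, p₂ - p⟫) : False := by
  have hpN : p ∈ N := interior_subset hp
  have hvN : ContinuousOn v N := hv.1.mono hNΩ
  obtain ⟨C, hC1, hC⟩ : ∃ C : ℝ, 1 ≤ C ∧ ∀ x ∈ N, 1 + ⟪ξ, x - p⟫ ≤ C := by
    obtain ⟨C, hC⟩ := (hN.image (f := fun x => 1 + ⟪ξ, x - p⟫) (by fun_prop)).bddAbove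
    have h : ∀ x ∈ N, 1 + ⟪ξ, x - p⟫ ≤ C := fun x hx => hC ⟨x, hx, rfl⟩
    exact ⟨C, by simpa using h p hpN, h⟩
  obtain ⟨Γ, hΓ⟩ := exists_section_ratio_bound hn hq0 hqn hlam hLam (C := C) (by linarith)
  set d := -⟪ξ, p₂ - p⟫ with hd
  have hd0 : 0 < d := by linarith
  obtain ⟨η, hη, hηΓ⟩ : ∃ η > 0, Γ < d / η := by
    refine ⟨d / (|Γ| + 1), by positivity, ?_⟩
    rw [div_div_cancel₀ hd0.ne']
    linarith [le_abs_self Γ]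
  -- away from the localized face, `v + |⟪a, · - p⟫|` is bounded below
  obtain ⟨g₀, hg₀, hg₁, hg₂⟩ : ∃ g₀ > 0,
      (∀ x ∈ frontier N, -1 ≤ 1 + ⟪ξ, x - p⟫ → g₀ ≤ v x + |⟪a, x - p⟫|) ∧
      ∀ x ∈ N, η ≤ ⟪ξ, x - p⟫ → g₀ ≤ v x + |⟪a, x - p⟫| := by
    have hfr : frontier N ⊆ N := hN.isClosed.frontier_subset
    have hcpt : IsCompact ((frontier N ∩ {x | -1 ≤ 1 + ⟪ξ, x - p⟫}) ∪
        (N ∩ {x | η ≤ ⟪ξ, x - p⟫})) :=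
      ((hN.of_isClosed_subset isClosed_frontier hfr).inter_right
        (isClosed_le (by fun_prop) (by fun_prop))).union
        (hN.inter_right (isClosed_le (by fun_prop) (by fun_prop)))
    have hsub : ((frontier N ∩ {x | -1 ≤ 1 + ⟪ξ, x - p⟫}) ∪
        (N ∩ {x | η ≤ ⟪ξ, x - p⟫})) ⊆ N := by
      rintro x (hx | hx)
      exacts [hfr hx.1, hx.1]
    obtain ⟨g₀, hg₀, hg⟩ := hcpt.exists_forall_le' (f := fun x => v x + |⟪a, x - p⟫|)
      ((hvN.mono hsub).add (by fun_prop)) (a := 0) (by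
        intro x hx
        have h0 := hv.2.2.1 x (hNΩ (hsub hx))
        refine lt_of_le_of_ne (by positivity) fun h => ?_
        have hvx : v x = 0 := by linarith [abs_nonneg ⟪a, x - p⟫]
        have hax : ⟪a, x - p⟫ = 0 := by
          rw [hvx, zero_add] at h
          exact abs_eq_zero.1 h.symm
        rcases hx with hx | hx
        · have := hfront x hx.1 hvx hax
          have h2 : -1 ≤ 1 + ⟪ξ, x - p⟫ := hx.2
          linarith
        · have := hface x hx.1 hvx hax
          have h2 : η ≤ ⟪ξ, x - p⟫ := hx.2
          linarith)
    exact ⟨g₀, hg₀, fun x hx hx' => hg x (Or.inl ⟨hx, hx'⟩), fun x hx hx' => hg x (Or.inr ⟨hx, hx'⟩)⟩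
  set e := (‖a‖ ^ 2)⁻¹ • a with he
  have hae : ⟪a, e⟫ = 1 := by
    rw [he, inner_smul_right, real_inner_self_eq_norm_sq,
      inv_mul_cancel₀ (pow_ne_zero 2 (norm_ne_zero_iff.2 ha))]
  obtain ⟨Y, hY, hYN, hYξ, hYg⟩ : ∃ Y > 0, p + Y • e ∈ N ∧ -1 < ⟪ξ, Y • e⟫ ∧
      v (p + Y • e) * (C + 1) + C * Y < g₀ := by
    have ht : Filter.Tendsto (fun Y : ℝ => p + Y • e) (nhds 0) (nhds p) := by
      have : Continuous fun Y : ℝ => p + Y • e := by fun_prop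
      simpa using this.tendsto 0
    have hNp : N ∈ nhds p := mem_interior_iff_mem_nhds.1 hp
    have h1 : ∀ᶠ Y : ℝ in nhds 0, p + Y • e ∈ N := ht.eventually hNp
    have h2 : ∀ᶠ Y : ℝ in nhds 0, -1 < ⟪ξ, Y • e⟫ := by
      have : Continuous fun Y : ℝ => ⟪ξ, Y • e⟫ := by fun_prop
      exact this.continuousAt.eventually_const_lt (by simp)
    have h3 : ∀ᶠ Y : ℝ in nhds 0, v (p + Y • e) * (C + 1) + C * Y < g₀ := by
      have h4 : Filter.Tendsto (fun Y : ℝ => v (p + Y • e)) (nhds 0) (nhds 0) := by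
        have := (hvN.continuousAt hNp).tendsto.comp ht
        rwa [hvp] at this
      have h5 : Filter.Tendsto (fun Y : ℝ => v (p + Y • e) * (C + 1) + C * Y) (nhds 0)
          (nhds (0 * (C + 1) + C * 0)) :=
        (h4.mul_const _).add (Filter.tendsto_id.const_mul C)
      exact h5.eventually_lt_const (by simpa using hg₀)
    obtain ⟨Y, hY1, hY0⟩ := (((h1.and (h2.and h3)).filter_mono nhdsWithin_le_nhds).and
      (self_mem_nhdsWithin (s := Ioi (0 : ℝ)))).exists
    exact ⟨Y, hY0, hY1⟩
  have hpos : ∀ x ∈ Ω, 0 < ⟪a, x - p⟫ → 0 < v x := fun x hx hax =>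
    lt_of_le_of_ne (hv.2.2.1 x hx) fun h => absurd (hK x hx h.symm) (not_le.2 hax)
  -- the slope of the supporting affine function on the slice `⟪a, · - p⟫ = Y`
  obtain ⟨z, ε, hzN, hzY, hε, hεz, hεY, hεT⟩ : ∃ z ε, z ∈ N ∧ ⟪a, z - p⟫ = Y ∧ 0 < ε ∧
      v z = ε * (2 + ⟪ξ, z - p⟫) ∧ ε ≤ v (p + Y • e) ∧
      ∀ x ∈ N, ⟪a, x - p⟫ = Y → ε * (2 + ⟪ξ, x - p⟫) ≤ v x := by
    have hTcpt : IsCompact (N ∩ {x | ⟪a, x - p⟫ = Y}) :=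
      hN.inter_right (isClosed_eq (by fun_prop) (by fun_prop))
    have hTpos : ∀ x ∈ N ∩ {x | ⟪a, x - p⟫ = Y}, 0 < v x := fun x hx =>
      hpos x (hNΩ hx.1) (by rw [hx.2]; exact hY)
    have hYT : p + Y • e ∈ N ∩ {x | ⟪a, x - p⟫ = Y} :=
      ⟨hYN, by simp [inner_smul_right, hae]⟩
    obtain ⟨z, hz, hzmax⟩ := hTcpt.exists_isMaxOn ⟨_, hYT⟩
      (f := fun x => (2 + ⟪ξ, x - p⟫) / v x)
      (ContinuousOn.div (by fun_prop) (hvN.mono inter_subset_left) fun x hx => (hTpos x hx).ne')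
    set m := (2 + ⟪ξ, z - p⟫) / v z with hm
    have hmax : ∀ x ∈ N ∩ {x | ⟪a, x - p⟫ = Y}, 2 + ⟪ξ, x - p⟫ ≤ m * v x := fun x hx =>
      (div_le_iff₀ (hTpos x hx)).1 (hzmax hx)
    have h1 : 1 ≤ m * v (p + Y • e) := by
      have := hmax _ hYT
      rw [add_sub_cancel_left] at this
      linarith
    have hm0 : 0 < m := pos_of_mul_pos_left (by linarith) (hTpos _ hYT).le
    refine ⟨z, m⁻¹, hz.1, hz.2, inv_pos.2 hm0, ?_, ?_, ?_⟩
    · rw [eq_inv_mul_iff_mul_eq₀ hm0.ne', hm, div_mul_cancel₀ _ (hTpos z hz).ne']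
    · rw [inv_le_iff_one_le_mul₀ hm0, mul_comm]; exact h1
    · intro x hx hxY
      rw [inv_mul_le_iff₀ hm0]
      exact hmax x ⟨hx, hxY⟩
  set b := ε • (ξ + Y⁻¹ • a) with hb
  set c := ε - ⟪b, p⟫ with hc
  have hL : ∀ x, ⟪b, x⟫ + c = ε * (1 + ⟪ξ, x - p⟫ + ⟪a, x - p⟫ / Y) := by
    intro x
    have : ⟪b, x - p⟫ = ε * (⟪ξ, x - p⟫ + ⟪a, x - p⟫ / Y) := by
      rw [hb, real_inner_smul_left, inner_add_left, real_inner_smul_left]; ring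
    rw [inner_sub_right] at this
    rw [hc]; linear_combination this
  have hSY : ∀ x ∈ N, v x ≤ ⟪b, x⟫ + c → ⟪a, x - p⟫ ≤ Y := by
    intro x hx hxS
    rw [hL] at hxS
    by_contra! hlt
    set t := Y / ⟪a, x - p⟫ with ht
    have hyx : 0 < ⟪a, x - p⟫ := hY.trans hlt
    have ht0 : 0 < t := div_pos hY hyx
    have ht1 : t < 1 := (div_lt_one hyx).2 hlt
    have hty : t * ⟪a, x - p⟫ = Y := div_mul_cancel₀ _ hyx.ne'
    have hw : (1 - t) • p + t • x - p = t • (x - p) := by module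
    have hwN : (1 - t) • p + t • x ∈ N := hNconv hpN hx (by linarith) ht0.le (by ring)
    have h1 := hεT _ hwN (by rw [hw, inner_smul_right, hty])
    rw [hw, inner_smul_right] at h1
    have h2 := hv.2.1.2 (hNΩ hpN) (hNΩ hx) (by linarith : 0 ≤ 1 - t) ht0.le (by ring)
    simp only [smul_eq_mul, hvp, mul_zero, zero_add] at h2
    have h3 := mul_le_mul_of_nonneg_left hxS ht0.le
    have h4 : t * (ε * (1 + ⟪ξ, x - p⟫ + ⟪a, x - p⟫ / Y)) =
        ε * (t * (1 + ⟪ξ, x - p⟫) + 1) := by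
      have : t * (⟪a, x - p⟫ / Y) = 1 := by rw [← mul_div_assoc, hty, div_self hY.ne']
      linear_combination ε * this
    have h5 := h1.trans (h2.trans (h3.trans_eq h4))
    have := le_of_mul_le_mul_left h5 hε
    linarith
  have hS : ∀ x ∈ N, v x ≤ ⟪b, x⟫ + c → v x ≤ (C + 1) * ε ∧ -(C * Y) ≤ ⟪a, x - p⟫ ∧
      -1 ≤ 1 + ⟪ξ, x - p⟫ ∧ v x + |⟪a, x - p⟫| < g₀ := by
    intro x hx hxS
    have hy := hSY x hx hxS
    rw [hL] at hxS
    have h0 := hv.2.2.1 x (hNΩ hx)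
    have hCx := hC x hx
    have hyY : ⟪a, x - p⟫ / Y ≤ 1 := (div_le_one hY).2 hy
    have hnn : 0 ≤ 1 + ⟪ξ, x - p⟫ + ⟪a, x - p⟫ / Y :=
      nonneg_of_mul_nonneg_right (h0.trans hxS) hε
    have h1 : v x ≤ (C + 1) * ε := by
      rw [mul_comm]
      exact hxS.trans (mul_le_mul_of_nonneg_left (by linarith) hε.le)
    have h2 : -(C * Y) ≤ ⟪a, x - p⟫ := by
      have : -C ≤ ⟪a, x - p⟫ / Y := by linarith
      rw [le_div_iff₀ hY] at this
      linarith
    refine ⟨h1, h2, by linarith, ?_⟩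
    have h3 : |⟪a, x - p⟫| ≤ C * Y := abs_le.2 ⟨h2, hy.trans (le_mul_of_one_le_left hY.le hC1)⟩
    have h4 : (C + 1) * ε ≤ v (p + Y • e) * (C + 1) := by
      rw [mul_comm]
      exact mul_le_mul_of_nonneg_right hεY (by linarith)
    linarith
  refine absurd (hΓ Ω N v b p p₂ z a ξ c ε η d Y hv hN hNconv hNΩ ?_ hpN hε ?_ hη hd0 hY hpos
    (fun x hx => (hS x hx.1 hx.2).1) (fun x hx => (hS x hx.1 hx.2).2.1) ?_ ?_ hzY ?_ ?_)
    (not_le.2 hηΓ)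
  · intro x hx hxS
    by_contra hint
    obtain ⟨-, -, h1, h2⟩ := hS x hx hxS
    exact absurd (hg₁ x ⟨subset_closure hx, hint⟩ h1) (not_le.2 h2)
  · rw [hL, hvp]; simp
  · intro x hx
    by_contra! hlt
    exact absurd (hg₂ x hx.1 hlt.le) (not_le.2 (hS x hx.1 hx.2).2.2.2)
  · refine ⟨hzN, ?_⟩
    rw [hL, hzY, div_self hY.ne', hεz]
    exact le_of_eq (by ring)
  · refine ⟨hp₂, ?_⟩
    rw [hL, hvp₂, hap₂, zero_div, add_zero]
    exact mul_nonneg hε.le (by linarith)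
  · rw [hd, neg_neg]

end FlatFace

section Exposed

variable {n : ℕ}

theorem GenSol.convex_coin {q lam Lam : ℝ} {Ω : Set (EuclideanSpace ℝ (Fin n))}
    {v : EuclideanSpace ℝ (Fin n) → ℝ} (hv : GenSol n q lam Lam Ω v) : Convex ℝ (coin Ω v) := by
  have h := hv.2.1.convex_le 0
  convert h using 1
  ext x
  exact and_congr_right fun hx => (hv.2.2.1 x hx).ge_iff_eq'.symm

theorem GenSol.mem_coin_of_mem_closure {q lam Lam : ℝ} {Ω : Set (EuclideanSpace ℝ (Fin n))}
    {v : EuclideanSpace ℝ (Fin n) → ℝ} (hv : GenSol n q lam Lam Ω v)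
    {x : EuclideanSpace ℝ (Fin n)} (hx : x ∈ Ω) (hxK : x ∈ closure (coin Ω v)) :
    x ∈ coin Ω v := by
  have h := ((hv.1 x hx).mono fun y hy => hy.1).mem_closure_image hxK
  have h2 : v '' coin Ω v ⊆ {0} := by
    rintro _ ⟨y, hy, rfl⟩
    exact hy.2
  exact ⟨hx, by simpa using closure_mono h2 h⟩

/-- If a linear function attains its maximum over a contact face of the coincidence set on a
compact set, then it is constant on that face. -/
theorem false_of_isCompact_top_face (hn : 0 < n) {q lam Lam : ℝ} (hq0 : 0 ≤ q) (hqn : q < n)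
    (hlam : 0 < lam) (hLam : 0 ≤ Lam) {Ω : Set (EuclideanSpace ℝ (Fin n))} (hΩ : IsOpen Ω)
    {v : EuclideanSpace ℝ (Fin n) → ℝ} (hv : GenSol n q lam Lam Ω v)
    {p p₂ a w : EuclideanSpace ℝ (Fin n)} (hpK : p ∈ coin Ω v) (ha : a ≠ 0)
    (hK : ∀ x ∈ coin Ω v, ⟪a, x - p⟫ ≤ 0)
    (htop : ∀ x ∈ coin Ω v, ⟪a, x - p⟫ = 0 → ⟪w, x - p⟫ ≤ 0)
    (hcpt : IsCompact (coin Ω v ∩ {x | ⟪a, x - p⟫ = 0 ∧ ⟪w, x - p⟫ = 0}))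
    (hp₂ : p₂ ∈ coin Ω v) (hap₂ : ⟪a, p₂ - p⟫ = 0) (hwp₂ : ⟪w, p₂ - p⟫ < 0) : False := by
  set P := coin Ω v ∩ {x | ⟪a, x - p⟫ = 0 ∧ ⟪w, x - p⟫ = 0} with hP
  have hKconv := hv.convex_coin
  have hPconv : Convex ℝ P := by
    refine hKconv.inter ?_
    intro x hx y hy s t _ _ hst
    have h : s • x + t • y - p = s • (x - p) + t • (y - p) := by
      rw [show s = 1 - t by linarith]; module
    constructor
    · rw [h, inner_add_right, inner_smul_right, inner_smul_right, hx.1, hy.1]; simp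
    · rw [h, inner_add_right, inner_smul_right, inner_smul_right, hx.2, hy.2]; simp
  obtain ⟨r, hr, hrΩ⟩ := hcpt.exists_cthickening_subset_open hΩ fun x hx => hx.1.1
  have hN : IsCompact (cthickening r P) := hcpt.cthickening
  have hPint : P ⊆ interior (cthickening r P) :=
    (self_subset_thickening hr P).trans (thickening_subset_interior_cthickening r P)
  have hp : p ∈ interior (cthickening r P) := hPint ⟨hpK, by simp, by simp⟩
  have hfr : frontier (cthickening r P) ⊆ cthickening r P := hN.isClosed.frontier_subset
  obtain ⟨τ, hτ, hτw⟩ : ∃ τ > 0, ∀ x ∈ frontier (cthickening r P), v x = 0 →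
      ⟪a, x - p⟫ = 0 → τ ≤ -⟪w, x - p⟫ := by
    have hGcpt : IsCompact ({x ∈ frontier (cthickening r P) | v x ≤ 0} ∩
        {x | ⟪a, x - p⟫ = 0}) :=
      (hN.of_isClosed_subset (isClosed_frontier.isClosed_le (hv.1.mono (hfr.trans hrΩ))
        continuousOn_const) fun x hx => hfr hx.1).inter_right
        (isClosed_eq (by fun_prop) (by fun_prop))
    obtain ⟨τ, hτ, h⟩ := hGcpt.exists_forall_le' (f := fun x => -⟪w, x - p⟫) (a := 0)
      (by fun_prop) (by
        rintro x ⟨⟨hx, hvx⟩, hax⟩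
        have hxK : x ∈ coin Ω v :=
          ⟨hrΩ (hfr hx), le_antisymm hvx (hv.2.2.1 x (hrΩ (hfr hx)))⟩
        have h1 := htop x hxK hax
        refine neg_pos.2 (lt_of_le_of_ne h1 fun h2 => hx.2 (hPint ⟨hxK, hax, h2⟩)))
    exact ⟨τ, hτ, fun x hx hvx hax => h x ⟨⟨hx, hvx.le⟩, hax⟩⟩
  have hξ : ∀ x, ⟪(3 / τ) • w, x - p⟫ = 3 / τ * ⟪w, x - p⟫ := fun x => real_inner_smul_left _ _ _
  obtain ⟨s, hs0, hs1, hsN, hsξ⟩ : ∃ s : ℝ, 0 < s ∧ s < 1 ∧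
      (1 - s) • p + s • p₂ ∈ cthickening r P ∧ -1 < s * ⟪(3 / τ) • w, p₂ - p⟫ := by
    have h1 : ∀ᶠ s : ℝ in nhds 0, (1 - s) • p + s • p₂ ∈ cthickening r P := by
      have : Continuous fun s : ℝ => (1 - s) • p + s • p₂ := by fun_prop
      refine this.continuousAt.eventually_mem ?_
      rw [sub_zero, one_smul, zero_smul, add_zero]
      exact mem_interior_iff_mem_nhds.1 hp
    have h2 : ∀ᶠ s : ℝ in nhds 0, -1 < s * ⟪(3 / τ) • w, p₂ - p⟫ := by
      have : Continuous fun s : ℝ => s * ⟪(3 / τ) • w, p₂ - p⟫ := by fun_prop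
      exact this.continuousAt.eventually_const_lt (by simp)
    have h3 : ∀ᶠ s : ℝ in nhds 0, s < 1 := eventually_lt_nhds one_pos
    obtain ⟨s, ⟨hs1, hs2, hs3⟩, hs0⟩ := (((h1.and (h2.and h3)).filter_mono
      nhdsWithin_le_nhds).and (self_mem_nhdsWithin (s := Ioi (0 : ℝ)))).exists
    exact ⟨s, hs0, hs3, hs1, hs2⟩
  have hsub : (1 - s) • p + s • p₂ - p = s • (p₂ - p) := by module
  refine false_of_localized_face hn hq0 hqn hlam hLam hv hN (hPconv.cthickening r) hrΩ hp hpK.2 ha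
    (fun x hx hvx => hK x ⟨hx, hvx⟩) (ξ := (3 / τ) • w) (p₂ := (1 - s) • p + s • p₂)
    ?_ ?_ hsN ?_ ?_ ?_ ?_
  · intro x hx hvx hax
    rw [hξ]
    exact mul_nonpos_of_nonneg_of_nonpos (by positivity) (htop x ⟨hrΩ hx, hvx⟩ hax)
  · intro x hx hvx hax
    rw [hξ]
    have h1 := mul_le_mul_of_nonneg_left (hτw x hx hvx hax) (by positivity : 0 ≤ 3 / τ)
    rw [div_mul_cancel₀ _ hτ.ne'] at h1
    linarith
  · exact (hKconv hpK hp₂ (by linarith) hs0.le (by ring)).2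
  · rw [hsub, inner_smul_right, hap₂, mul_zero]
  · rw [hsub, inner_smul_right, hξ]
    exact mul_neg_of_pos_of_neg hs0 (mul_neg_of_pos_of_neg (by positivity) hwp₂)
  · rw [hsub, inner_smul_right]; exact hsξ.le

/-- Supporting hyperplane theorem in `ℝⁿ`. -/
theorem exists_inner_sub_nonpos {K : Set (EuclideanSpace ℝ (Fin n))} (hK : Convex ℝ K)
    {x₀ : EuclideanSpace ℝ (Fin n)} (hx₀ : x₀ ∈ K) (hint : x₀ ∉ interior K) :
    ∃ a : EuclideanSpace ℝ (Fin n), a ≠ 0 ∧ ∀ x ∈ K, ⟪a, x - x₀⟫ ≤ 0 := by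
  rcases (interior K).eq_empty_or_nonempty with hemp | hne
  · have h1 : affineSpan ℝ K ≠ ⊤ := fun h => by
      have := hK.interior_nonempty_iff_affineSpan_eq_top.2 h
      rw [hemp] at this
      exact not_nonempty_empty this
    have h2 : vectorSpan ℝ K ≠ ⊤ := fun h =>
      h1 ((AffineSubspace.affineSpan_eq_top_iff_vectorSpan_eq_top_of_nonempty ℝ _ _ ⟨x₀, hx₀⟩).2 h)
    obtain ⟨a, haV, ha⟩ := Submodule.exists_mem_ne_zero_of_ne_bot
      (mt Submodule.orthogonal_eq_bot_iff.1 h2)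
    refine ⟨a, ha, fun x hx => ?_⟩
    rw [real_inner_comm]
    exact ((Submodule.mem_orthogonal _ _).1 haV _ (vsub_mem_vectorSpan ℝ hx hx₀)).le
  · obtain ⟨f, hf⟩ := geometric_hahn_banach_open_point hK.interior isOpen_interior hint
    set a := (InnerProductSpace.toDual ℝ (EuclideanSpace ℝ (Fin n))).symm f with ha
    have haf : ∀ x, ⟪a, x⟫ = f x := fun x => InnerProductSpace.toDual_symm_apply
    refine ⟨a, ?_, fun x hx => ?_⟩
    · rintro h0
      obtain ⟨y, hy⟩ := hne
      have := hf y hy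
      rw [← haf, ← haf, h0] at this
      simp at this
    · have hcl : x ∈ closure (interior K) := by
        rw [hK.closure_interior_eq_closure_of_nonempty_interior hne]
        exact subset_closure hx
      have hle : f x ≤ f x₀ := closure_minimal (fun y hy => (hf y hy).le)
        (isClosed_le f.continuous continuous_const) hcl
      rw [haf, map_sub]
      linarith

/-- If the part of the coincidence set in a half-space is compact, then its boundary points there
are exposed. -/
theorem mem_exposedPoints_of_isCompact_halfSpace (hn : 0 < n) {q lam Lam : ℝ} (hq0 : 0 ≤ q)
    (hqn : q < n) (hlam : 0 < lam) (hLam : 0 ≤ Lam) {Ω : Set (EuclideanSpace ℝ (Fin n))}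
    (hΩ : IsOpen Ω) {v : EuclideanSpace ℝ (Fin n) → ℝ} (hv : GenSol n q lam Lam Ω v)
    {g x₀ : EuclideanSpace ℝ (Fin n)} {δ : ℝ}
    (hcpt : IsCompact (coin Ω v ∩ {x | ⟪g, x⟫ ≤ δ})) (hx₀ : x₀ ∈ Ω ∩ frontier (coin Ω v))
    (hgx₀ : ⟪g, x₀⟫ ≤ δ) : x₀ ∈ Set.exposedPoints ℝ (coin Ω v) := by
  have hx₀K : x₀ ∈ coin Ω v := hv.mem_coin_of_mem_closure hx₀.1 hx₀.2.1
  obtain ⟨a, ha, haK⟩ := exists_inner_sub_nonpos hv.convex_coin hx₀K hx₀.2.2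
  by_contra hexp
  obtain ⟨x₁, hx₁K, hax₁, hx₁⟩ : ∃ x₁ ∈ coin Ω v, ⟪a, x₁ - x₀⟫ = 0 ∧ x₁ ≠ x₀ := by
    by_contra! h
    refine hexp (exposed_point_def.2 ⟨hx₀K, innerSL ℝ a, fun y hy => ?_⟩)
    have h1 := haK y hy
    rw [innerSL_apply_apply, innerSL_apply_apply]
    refine ⟨by rw [inner_sub_right] at h1; linarith, fun h2 => h y hy (le_antisymm h1 ?_)⟩
    rw [inner_sub_right]; linarith
  have hshift : ∀ {p}, ⟪a, p - x₀⟫ = 0 → ∀ x, ⟪a, x - p⟫ = ⟪a, x - x₀⟫ := fun {p} hp x => by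
    rw [inner_sub_right] at hp ⊢
    rw [inner_sub_right]; linarith
  by_cases hconst : ∀ x ∈ coin Ω v, ⟪a, x - x₀⟫ = 0 → ⟪g, x⟫ = ⟪g, x₀⟫
  · have hF : IsCompact (coin Ω v ∩ {x | ⟪a, x - x₀⟫ = 0}) := by
      convert hcpt.inter_right (isClosed_eq (f := fun x => ⟪a, x - x₀⟫) (g := fun _ => (0 : ℝ))
        (by fun_prop) (by fun_prop)) using 1
      ext x
      exact ⟨fun h => ⟨⟨h.1, (hconst x h.1 h.2).trans_le hgx₀⟩, h.2⟩, fun h => ⟨h.1.1, h.2⟩⟩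
    obtain ⟨p, hp, hpmax⟩ := hF.exists_isMaxOn ⟨x₀, hx₀K, by simp⟩
      (f := fun x => ⟪x₁ - x₀, x⟫) (by fun_prop)
    have hmax : ∀ x ∈ coin Ω v, ⟪a, x - x₀⟫ = 0 → ⟪x₁ - x₀, x - p⟫ ≤ 0 := fun x hx hax => by
      have h : ⟪x₁ - x₀, x⟫ ≤ ⟪x₁ - x₀, p⟫ := hpmax ⟨hx, hax⟩
      rw [inner_sub_right]; linarith
    refine false_of_isCompact_top_face hn hq0 hqn hlam hLam hΩ hv (p := p) (p₂ := x₀) (a := a)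
      (w := x₁ - x₀) hp.1 ha (fun x hx => ?_) (fun x hx hax => ?_) ?_ hx₀K ?_ ?_
    · rw [hshift hp.2]; exact haK x hx
    · rw [hshift hp.2] at hax; exact hmax x hx hax
    · convert hF.inter_right (isClosed_eq (f := fun x => ⟪x₁ - x₀, x - p⟫)
        (g := fun _ => (0 : ℝ)) (by fun_prop) (by fun_prop)) using 1
      ext x
      simp only [mem_inter_iff, mem_ofPred_eq, hshift hp.2, and_assoc]
    · rw [hshift hp.2]; simp
    · have h1 := hmax x₁ hx₁K hax₁
      have h2 : 0 < ⟪x₁ - x₀, x₁ - x₀⟫ := real_inner_self_pos.2 (sub_ne_zero.2 hx₁)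
      rw [inner_sub_right] at h1 h2 ⊢
      linarith
  · push Not at hconst
    obtain ⟨y, hyK, hay, hgy⟩ := hconst
    have hF : IsCompact ((coin Ω v ∩ {x | ⟪g, x⟫ ≤ δ}) ∩ {x | ⟪a, x - x₀⟫ = 0}) :=
      hcpt.inter_right (isClosed_eq (by fun_prop) (by fun_prop))
    obtain ⟨p, hp, hpmin⟩ := hF.exists_isMinOn ⟨x₀, ⟨hx₀K, hgx₀⟩, by simp⟩
      (f := fun x => ⟪g, x⟫) (by fun_prop)
    have hmin : ∀ x ∈ coin Ω v, ⟪a, x - x₀⟫ = 0 → ⟪g, p⟫ ≤ ⟪g, x⟫ := fun x hx hax => by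
      by_cases h : ⟪g, x⟫ ≤ δ
      · exact hpmin ⟨⟨hx, h⟩, hax⟩
      · exact (hp.1.2.trans (not_le.1 h).le)
    obtain ⟨p₂, hp₂K, hap₂, hgp₂⟩ : ∃ p₂ ∈ coin Ω v, ⟪a, p₂ - x₀⟫ = 0 ∧ ⟪g, p⟫ < ⟪g, p₂⟫ := by
      rcases (hmin x₀ hx₀K (by simp)).lt_or_eq with h | h
      · exact ⟨x₀, hx₀K, by simp, h⟩
      · exact ⟨y, hyK, hay, lt_of_le_of_ne (hmin y hyK hay) (h ▸ hgy.symm)⟩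
    refine false_of_isCompact_top_face hn hq0 hqn hlam hLam hΩ hv (p := p) (p₂ := p₂) (a := a)
      (w := -g) hp.1.1 ha (fun x hx => ?_) (fun x hx hax => ?_) ?_ hp₂K ?_ ?_
    · rw [hshift hp.2]; exact haK x hx
    · rw [hshift hp.2] at hax
      have := hmin x hx hax
      rw [inner_neg_left, inner_sub_right]; linarith
    · convert hF.inter_right (isClosed_eq (f := fun x => ⟪-g, x - p⟫)
        (g := fun _ => (0 : ℝ)) (by fun_prop) (by fun_prop)) using 1
      ext x
      simp only [mem_inter_iff, mem_ofPred_eq, hshift hp.2]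
      refine ⟨fun h => ⟨⟨⟨h.1, ?_⟩, h.2.1⟩, h.2.2⟩, fun h => ⟨h.1.1.1, h.1.2, h.2⟩⟩
      have h1 := h.2.2
      have h2 : ⟪g, p⟫ ≤ δ := hp.1.2
      rw [inner_neg_left, inner_sub_right] at h1
      linarith
    · rw [hshift hp.2]; exact hap₂
    · rw [inner_neg_left, inner_sub_right]; linarith

/-- Near an exposed point of the coincidence set in `Ω`, all its boundary points are exposed. -/
theorem exists_isOpen_subset_exposedPoints (hn : 0 < n) {q lam Lam : ℝ} (hq0 : 0 ≤ q)
    (hqn : q < n) (hlam : 0 < lam) (hLam : 0 ≤ Lam) {Ω : Set (EuclideanSpace ℝ (Fin n))}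
    (hΩ : IsOpen Ω) {v : EuclideanSpace ℝ (Fin n) → ℝ} (hv : GenSol n q lam Lam Ω v)
    {x₀ : EuclideanSpace ℝ (Fin n)} (hx₀ : x₀ ∈ Set.exposedPoints ℝ (coin Ω v)) :
    ∃ U : Set (EuclideanSpace ℝ (Fin n)), IsOpen U ∧ x₀ ∈ U ∧
      U ∩ (Ω ∩ frontier (coin Ω v)) ⊆ Set.exposedPoints ℝ (coin Ω v) := by
  obtain ⟨hx₀K, l, hl⟩ := exposed_point_def.1 hx₀
  set g := -(InnerProductSpace.toDual ℝ (EuclideanSpace ℝ (Fin n))).symm l with hg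
  have hgl : ∀ x, ⟪g, x⟫ = -l x := fun x => by
    rw [hg, inner_neg_left, InnerProductSpace.toDual_symm_apply]
  obtain ⟨r, hr, hrΩ⟩ := Metric.nhds_basis_closedBall.mem_iff.1 (hΩ.mem_nhds hx₀K.1)
  have hcpt : ∀ s ⊆ closedBall x₀ r, IsClosed s → IsCompact (coin Ω v ∩ s) := by
    intro s hs hcl
    have hsc := (isCompact_closedBall x₀ r).of_isClosed_subset hcl hs
    have hEq : coin Ω v ∩ s = {x ∈ s | v x ≤ 0} := by
      ext x
      exact ⟨fun h => ⟨h.2, h.1.2.le⟩, fun h => ⟨⟨hrΩ (hs h.1),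
        le_antisymm h.2 (hv.2.2.1 x (hrΩ (hs h.1)))⟩, h.1⟩⟩
    rw [hEq]
    exact hsc.of_isClosed_subset (hcl.isClosed_le (hv.1.mono (hs.trans hrΩ))
      continuousOn_const) fun x hx => hx.1
  obtain ⟨τ, hτ, hsph⟩ := (hcpt (sphere x₀ r) sphere_subset_closedBall
    isClosed_sphere).exists_forall_le' (f := fun x => l x₀ - l x) (a := 0) (by fun_prop) (by
      rintro x ⟨hxK, hxr⟩
      obtain ⟨h1, h2⟩ := hl x hxK
      refine sub_pos.2 (lt_of_le_of_ne h1 fun h => hr.ne ?_)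
      have h3 := h2 h.ge
      rw [h3, mem_sphere, dist_self] at hxr
      exact hxr)
  have hcap : ∀ x ∈ coin Ω v, ⟪g, x⟫ ≤ -l x₀ + τ / 2 → x ∈ closedBall x₀ r := by
    intro x hxK hx
    rw [hgl] at hx
    by_contra hxr
    have hxr' : r < dist x x₀ := not_le.1 hxr
    have hd : 0 < dist x x₀ := hr.trans hxr'
    set t := r / dist x x₀ with ht
    have ht0 : 0 < t := div_pos hr hd
    have ht1 : t < 1 := (div_lt_one hd).2 hxr'
    have hw := hv.convex_coin hx₀K hxK (by linarith : 0 ≤ 1 - t) ht0.le (by ring)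
    have h1 : (1 - t) • x₀ + t • x ∈ sphere x₀ r := by
      rw [mem_sphere, dist_eq_norm, show (1 - t) • x₀ + t • x - x₀ = t • (x - x₀) by module,
        norm_smul, Real.norm_of_nonneg ht0.le, ← dist_eq_norm, div_mul_cancel₀ _ hd.ne']
    have h2 : τ ≤ l x₀ - l ((1 - t) • x₀ + t • x) := hsph _ ⟨hw, h1⟩
    simp only [map_add, map_smul, smul_eq_mul] at h2
    have h3 : t * (l x₀ - l x) ≤ 1 * (τ / 2) :=
      mul_le_mul ht1.le (by linarith) (sub_nonneg.2 (hl x hxK).1) zero_le_one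
    linarith
  have hcpt' : IsCompact (coin Ω v ∩ {x | ⟪g, x⟫ ≤ -l x₀ + τ / 2}) := by
    convert hcpt (closedBall x₀ r ∩ {x | ⟪g, x⟫ ≤ -l x₀ + τ / 2}) inter_subset_left
      (isClosed_closedBall.inter (isClosed_le (by fun_prop) (by fun_prop))) using 1
    ext x
    exact ⟨fun h => ⟨h.1, hcap x h.1 h.2, h.2⟩, fun h => ⟨h.1, h.2.2⟩⟩
  refine ⟨{x | ⟪g, x⟫ < -l x₀ + τ / 2}, isOpen_lt (by fun_prop) (by fun_prop), ?_, ?_⟩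
  · rw [mem_ofPred_eq, hgl]; linarith
  · rintro x ⟨hx, hxK⟩
    exact mem_exposedPoints_of_isCompact_halfSpace hn hq0 hqn hlam hLam hΩ hv hcpt' hxK hx.le

theorem notMem_interior_of_mem_exposedPoints (hn : 0 < n) {K : Set (EuclideanSpace ℝ (Fin n))}
    {x : EuclideanSpace ℝ (Fin n)} (hx : x ∈ Set.exposedPoints ℝ K) : x ∉ interior K := by
  intro hint
  obtain ⟨-, l, hl⟩ := exposed_point_def.1 hx
  obtain ⟨r, hr, hrK⟩ := Metric.nhds_basis_closedBall.mem_iff.1 (mem_interior_iff_mem_nhds.1 hint)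
  set u : EuclideanSpace ℝ (Fin n) := EuclideanSpace.single ⟨0, hn⟩ r with hu
  have hur : ‖u‖ = r := by rw [hu, PiLp.norm_single, Real.norm_of_nonneg hr.le]
  have hu0 : u ≠ 0 := fun h => by rw [h, norm_zero] at hur; exact hr.ne hur
  obtain ⟨h1, h2⟩ := hl (x + u) (hrK (by simp [hur]))
  obtain ⟨h3, -⟩ := hl (x - u) (hrK (by simp [hur]))
  rw [map_sub] at h3
  rw [map_add] at h1 h2
  exact hu0 (by simpa using h2 (by linarith))

theorem lastCoord_eq_inner (hn : 0 < n) (x : EuclideanSpace ℝ (Fin n)) :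
    lastCoord x = ⟪EuclideanSpace.single (⟨n - 1, by omega⟩ : Fin n) (1 : ℝ), x⟫ := by
  rw [lastCoord, dif_pos hn, EuclideanSpace.inner_single_left]
  simp

end Exposed

/-- **Openness of the strictly convex part of the free boundary** (Lemma 2.12): if
`K ⊆ {x_n ≥ 0}` and `K ∩ {x_n ≤ δ}` is a nonempty compact subset of `Ω`, then every point of
`Ω ∩ ∂K ∩ {x_n ≤ δ}` is an exposed point of `K`; consequently, for any generalized
solution, `Γ_sc = {exposed points of K} ∩ Ω` is a relatively open subset of `Ω ∩ ∂K`. -/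
theorem exposed_points_of_low_slab
    (n : ℕ) (hn : 2 ≤ n) (q lam Lam : ℝ)
    (hq0 : 0 ≤ q) (hqn : q < n) (hlam : 0 < lam) (hlL : lam ≤ Lam)
    (Ω : Set (EuclideanSpace ℝ (Fin n))) (hΩo : IsOpen Ω) (hΩc : Convex ℝ Ω)
    (v : EuclideanSpace ℝ (Fin n) → ℝ) (hv : GenSol n q lam Lam Ω v)
    (δ : ℝ) (hδ : 0 < δ)
    (hKhalf : ∀ x ∈ coin Ω v, 0 ≤ lastCoord x)
    (hKslab : IsCompact (coin Ω v ∩ {x | lastCoord x ≤ δ}))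
    (hKslabne : (coin Ω v ∩ {x | lastCoord x ≤ δ}).Nonempty)
    (hKslabΩ : coin Ω v ∩ {x | lastCoord x ≤ δ} ⊆ Ω) :
    (∀ x ∈ Ω ∩ frontier (coin Ω v), lastCoord x ≤ δ →
      x ∈ Set.exposedPoints ℝ (coin Ω v)) ∧
    -- consequently: for any generalized solution, Γ_sc is relatively open in Ω ∩ ∂K
    (∀ v₂ : EuclideanSpace ℝ (Fin n) → ℝ, GenSol n q lam Lam Ω v₂ →
      ∃ U : Set (EuclideanSpace ℝ (Fin n)), IsOpen U ∧
        {x ∈ Ω | x ∈ Set.exposedPoints ℝ (coin Ω v₂)}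
          = U ∩ (Ω ∩ frontier (coin Ω v₂))) := by
  have hn0 : 0 < n := by omega
  have hLam : 0 ≤ Lam := hlam.le.trans hlL
  constructor
  · intro x hx hxδ
    simp only [lastCoord_eq_inner hn0] at hKslab hxδ
    exact mem_exposedPoints_of_isCompact_halfSpace hn0 hq0 hqn hlam hLam hΩo hv hKslab hx hxδ
  · intro v₂ hv₂
    choose! U hUo hUmem hUsub using fun x₀ (hx₀ : x₀ ∈ Set.exposedPoints ℝ (coin Ω v₂)) =>
      exists_isOpen_subset_exposedPoints hn0 hq0 hqn hlam hLam hΩo hv₂ hx₀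
    refine ⟨⋃ x₀ ∈ Set.exposedPoints ℝ (coin Ω v₂), U x₀, isOpen_biUnion hUo, ?_⟩
    ext x
    constructor
    · rintro ⟨hxΩ, hx⟩
      exact ⟨mem_biUnion hx (hUmem x hx), hxΩ, subset_closure (exposedPoints_subset hx),
        notMem_interior_of_mem_exposedPoints hn0 hx⟩
    · rintro ⟨hxU, hx⟩
      obtain ⟨x₀, hx₀, hxU⟩ := mem_iUnion₂.1 hxU
      exact ⟨hx.1, hUsub x₀ hx₀ ⟨hxU, hx⟩⟩
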